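/- Let f ∈ L¹(−1,1). The following conditions are equivalent: (a) for every measurable h on (−1,1) with |h| ≤ |f| a.e., T(h) ∈ L_exp; (b) for every Borel set A ⊆ (−1,1), T(f·χ_A) ∈ L_exp; (c) for every measurable θ : (−1,1) → ℂ with |θ| = 1 a.e., T(θ·f) ∈ L_exp; (d) f·T(g) ∈ L¹(−1,1) for every g ∈ LlogL. -/

import Mathlib

open MeasureTheory Filter Set

/-- Lebesgue measure restricted to the interval `(-1, 1)`. -/
noncomputable def mIoo : MeasureTheory.Measure ℝ :=
  MeasureTheory.volume.restrict (Set.Ioo (-1 : ℝ) 1)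

/-- The finite Hilbert transform: `T f t` is the principal value
`lim_{ε→0⁺} (1/π) (∫_{-1}^{t-ε} + ∫_{t+ε}^{1}) f x / (x - t) dx`. -/
noncomputable def FHT (f : ℝ → ℂ) (t : ℝ) : ℂ :=
  limUnder (nhdsWithin (0 : ℝ) (Set.Ioi 0)) fun ε =>
    (Real.pi : ℂ)⁻¹ * ((∫ x in Set.Ioo (-1 : ℝ) (t - ε), f x / (↑x - ↑t)) +
      ∫ x in Set.Ioo (t + ε) (1 : ℝ), f x / (↑x - ↑t))

/-- `w x = √(1 - x²)`. -/
noncomputable def w (x : ℝ) : ℝ := Real.sqrt (1 - x ^ 2)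

/-- The operator `Ť f = -w · T(f / w)`. -/
noncomputable def Tcheck (f : ℝ → ℂ) (t : ℝ) : ℂ :=
  -((w t : ℂ) * FHT (fun y => f y / (w y : ℂ)) t)

/-- The operator `T̂ f = -(1/w) · T(w f)`. -/
noncomputable def That (f : ℝ → ℂ) (t : ℝ) : ℂ :=
  -(FHT (fun y => (w y : ℂ) * f y) t / (w t : ℂ))

/-- Membership in the Zygmund space `L_exp^α`: `f` is measurable and there is `λ > 0` with
`∫ exp(λ |f|^(1/α)) < ∞`. -/
def MemLexpPow (α : ℝ) (f : ℝ → ℂ) : Prop :=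
  MeasureTheory.AEStronglyMeasurable f mIoo ∧
    ∃ l > (0 : ℝ),
      ∫⁻ x, ENNReal.ofReal (Real.exp (l * ‖f x‖ ^ ((1 : ℝ) / α))) ∂mIoo < ⊤

/-- Membership in the Zygmund space `L_exp`: `f` is measurable and there is `λ > 0` with
`∫ exp(λ |f|) < ∞`. -/
def MemLexp (f : ℝ → ℂ) : Prop :=
  MeasureTheory.AEStronglyMeasurable f mIoo ∧
    ∃ l > (0 : ℝ), ∫⁻ x, ENNReal.ofReal (Real.exp (l * ‖f x‖)) ∂mIoo < ⊤

/-- Membership in the Zygmund space `L log L`: `g` is measurable and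
`∫ |g| log(2 + |g|) < ∞`. -/
def MemLlogL (g : ℝ → ℂ) : Prop :=
  MeasureTheory.AEStronglyMeasurable g mIoo ∧
    MeasureTheory.Integrable (fun x => ‖g x‖ * Real.log (2 + ‖g x‖)) mIoo

section

open scoped ENNReal Topology

theorem integral_horizontal_line_eq_zero {H : ℂ → ℂ} {s C : ℝ} (hs : 0 ≤ s)
    (hd : DifferentiableOn ℂ H {z | s ≤ z.im})
    (hb : ∀ z : ℂ, s ≤ z.im → ‖H z‖ ≤ C / (1 + ‖z‖ ^ 2)) :
    (Integrable fun t : ℝ => H (t + s * Complex.I)) ∧ ∫ t : ℝ, H (t + s * Complex.I) = 0 := by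
  have hC : 0 ≤ C := by
    have := (norm_nonneg _).trans (hb (s * Complex.I) (by simp))
    by_contra! hneg
    exact absurd this (not_le.2 (div_neg_of_neg_of_pos hneg (by positivity)))
  have hcont : Continuous fun t : ℝ => H (t + s * Complex.I) := by
    have h1 : ContinuousOn H {z | s ≤ z.im} := hd.continuousOn
    refine h1.comp_continuous (by fun_prop) ?_
    intro t; simp
  have hint : Integrable fun t : ℝ => H (t + s * Complex.I) := by
    refine (integrable_inv_one_add_sq.const_mul C).mono' hcont.aestronglyMeasurable ?_
    refine Eventually.of_forall fun t => (hb _ (by simp)).trans ?_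
    rw [div_eq_mul_inv]
    have := Complex.abs_re_le_norm (t + s * Complex.I)
    simp only [Complex.add_re, Complex.ofReal_re, Complex.mul_re, Complex.I_re, mul_zero,
      Complex.ofReal_im, zero_mul, sub_self, add_zero] at this
    have h2 : t ^ 2 ≤ ‖(t + s * Complex.I : ℂ)‖ ^ 2 := by
      rw [← sq_abs]; gcongr
    gcongr C * (1 + ?_)⁻¹
  have hlim := intervalIntegral_tendsto_integral hint tendsto_neg_atTop_atBot tendsto_id
  have hlim0 : Tendsto (fun R : ℝ => ∫ t in (-R)..R, H (t + s * Complex.I)) atTop (nhds 0) := by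
    have hbd : ∀ R : ℝ, 0 < R → ‖∫ t in (-R)..R, H (t + s * Complex.I)‖ ≤ 4 * C / R := by
      intro R hR
      have key := Complex.integral_boundary_rect_eq_zero_of_differentiableOn H
        (-R + s * Complex.I) (R + (s + R : ℝ) * Complex.I) (hd.mono ?_)
      · simp only [Complex.add_re, Complex.neg_re, Complex.ofReal_re, Complex.mul_re, Complex.I_re,
          mul_zero, Complex.ofReal_im, Complex.I_im, mul_one, sub_self, add_zero, Complex.add_im,
          Complex.neg_im, neg_zero, Complex.mul_im, zero_add, smul_eq_mul] at key
        have hR2 : ∀ z : ℂ, s ≤ z.im → R ≤ ‖z‖ → ‖H z‖ ≤ C / R ^ 2 := by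
          intro z hz hzR
          refine (hb z hz).trans ?_
          gcongr
          nlinarith
        have e1 : ‖∫ x in (-R)..R, H (x + (s + R : ℝ) * Complex.I)‖ ≤ C / R ^ 2 * |R - -R| := by
          refine intervalIntegral.norm_integral_le_of_norm_le_const fun x _ => hR2 _ (by simp [hR.le]) ?_
          have := Complex.abs_im_le_norm (x + (s + R : ℝ) * Complex.I)
          simp only [Complex.add_im, Complex.ofReal_im, Complex.mul_im, Complex.ofReal_re,
            Complex.I_im, mul_one, Complex.I_re, mul_zero, add_zero, zero_add] at this
          linarith [le_abs_self (s + R)]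
        have e2 : ‖∫ y in s..(s + R), H ((R : ℝ) + y * Complex.I)‖ ≤ C / R ^ 2 * |s + R - s| := by
          refine intervalIntegral.norm_integral_le_of_norm_le_const fun x hx => hR2 _ ?_ ?_
          · rw [uIoc_of_le (by linarith)] at hx
            simp [hx.1.le]
          · have := Complex.abs_re_le_norm ((R : ℝ) + x * Complex.I)
            simp at this
            linarith [le_abs_self R]
        have e3 : ‖∫ y in s..(s + R), H (-R + y * Complex.I)‖ ≤ C / R ^ 2 * |s + R - s| := by
          refine intervalIntegral.norm_integral_le_of_norm_le_const fun x hx => hR2 _ ?_ ?_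
          · rw [uIoc_of_le (by linarith)] at hx
            simp [hx.1.le]
          · have := Complex.abs_re_le_norm (-(R : ℂ) + x * Complex.I)
            simp at this
            linarith [le_abs_self R]
        have key2 : (∫ t in (-R)..R, H (t + s * Complex.I)) =
            (∫ x in (-R)..R, H (x + (s + R : ℝ) * Complex.I))
            - Complex.I * (∫ y in s..(s + R), H ((R : ℝ) + y * Complex.I))
            + Complex.I * (∫ y in s..(s + R), H (-R + y * Complex.I)) := by
          push_cast at key ⊢
          linear_combination key
        rw [key2]
        refine (norm_add_le _ _).trans ((add_le_add_left (norm_sub_le _ _) _).trans ?_)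
        rw [norm_mul, norm_mul, Complex.norm_I, one_mul, one_mul]
        refine (add_le_add (add_le_add e1 e2) e3).trans (le_of_eq ?_)
        rw [show R - -R = 2 * R by ring, show s + R - s = R by ring, abs_of_pos hR,
          abs_of_pos (by positivity)]
        field_simp
        ring
      · intro z hz
        have := hz.2
        simp only [mem_preimage, Complex.add_im, Complex.neg_im, Complex.ofReal_im, neg_zero, Complex.mul_im, Complex.ofReal_re,
          Complex.I_im, mul_one, Complex.I_re, mul_zero, add_zero, zero_add] at this
        rw [uIcc_of_le (by linarith)] at this
        exact this.1
    refine squeeze_zero_norm' ((eventually_gt_atTop 0).mono fun R hR => hbd R hR) ?_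
    exact tendsto_const_nhds.div_atTop tendsto_id
  exact ⟨hint, tendsto_nhds_unique hlim hlim0⟩

/-- The Cauchy transform `z ↦ ∫ u(x) / (i (x - z)) dx`, which has nonnegative real part on the
upper half plane when `u ≥ 0`. -/
noncomputable def cauchyW (u : ℝ → ℝ) (z : ℂ) : ℂ :=
  ∫ x : ℝ, (u x : ℂ) * (-Complex.I / (x - z))

theorem im_le_norm_ofReal_sub (x : ℝ) (z : ℂ) : z.im ≤ ‖(x : ℂ) - z‖ := by
  have := Complex.abs_im_le_norm ((x : ℂ) - z)
  simp only [Complex.sub_im, Complex.ofReal_im, zero_sub, abs_neg] at this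
  exact (le_abs_self _).trans this

theorem ofReal_sub_ne_zero {z : ℂ} (hz : 0 < z.im) (x : ℝ) : (x : ℂ) - z ≠ 0 :=
  norm_pos_iff.1 (hz.trans_le (im_le_norm_ofReal_sub x z))

theorem continuous_inv_ofReal_sub {z : ℂ} (hz : 0 < z.im) :
    Continuous fun x : ℝ => -Complex.I / ((x : ℂ) - z) :=
  Continuous.div continuous_const (by fun_prop) (ofReal_sub_ne_zero hz)

theorem integrable_cauchyW {u : ℝ → ℝ} (hu : Integrable u) {z : ℂ} (hz : 0 < z.im) :
    Integrable fun x : ℝ => (u x : ℂ) * (-Complex.I / (x - z)) := by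
  refine hu.ofReal.mul_bdd (c := 1 / z.im)
    (continuous_inv_ofReal_sub hz).aestronglyMeasurable (Eventually.of_forall fun x => ?_)
  rw [norm_div, norm_neg, Complex.norm_I]
  exact one_div_le_one_div_of_le hz (im_le_norm_ofReal_sub x z)

theorem norm_cauchyW_le {u : ℝ → ℝ} (hu : Integrable u) {z : ℂ} {c : ℝ}
    (h : ∀ x, u x ≠ 0 → 1 ≤ c * ‖(x : ℂ) - z‖) :
    ‖cauchyW u z‖ ≤ (∫ x, |u x|) * c := by
  rw [← integral_mul_const]
  refine norm_integral_le_of_norm_le (hu.abs.mul_const c) (Eventually.of_forall fun x => ?_)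
  rw [norm_mul, norm_div, norm_neg, Complex.norm_I, Complex.norm_real, Real.norm_eq_abs]
  by_cases hx : u x = 0
  · simp [hx]
  · gcongr
    have h1 := h x hx
    have h0 : 0 < ‖(x : ℂ) - z‖ := by
      rcases (norm_nonneg ((x : ℂ) - z)).eq_or_lt with h2 | h2
      · rw [← h2] at h1; norm_num at h1
      · exact h2
    rw [div_le_iff₀ h0]; exact h1

theorem norm_cauchyW_sq_le {u : ℝ → ℝ} (hu : Integrable u) {R s : ℝ} (hs : 0 < s) (hR : 0 ≤ R)
    (hsupp : ∀ x, R < |x| → u x = 0) {z : ℂ} (hz : s ≤ z.im) :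
    ‖cauchyW u z‖ ^ 2 ≤ (∫ x, |u x|) ^ 2 * ((1 / s) ^ 2 + (1 + R / s) ^ 2) / (1 + ‖z‖ ^ 2) := by
  have hM : 0 ≤ ∫ x, |u x| := integral_nonneg fun x => abs_nonneg _
  have hz0 : 0 < ‖z‖ := (hs.trans_le hz).trans_le ((le_abs_self _).trans (Complex.abs_im_le_norm z))
  have h1 : ‖cauchyW u z‖ ≤ (∫ x, |u x|) * (1 / s) := by
    refine norm_cauchyW_le hu fun x _ => ?_
    have := hz.trans (im_le_norm_ofReal_sub x z)
    rw [one_div, inv_mul_eq_div, one_le_div hs]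
    exact this
  have h2 : ‖cauchyW u z‖ ≤ (∫ x, |u x|) * ((1 + R / s) / ‖z‖) := by
    refine norm_cauchyW_le hu fun x hx => ?_
    have h3 := hz.trans (im_le_norm_ofReal_sub x z)
    have h4 : |x| ≤ R := not_lt.1 fun h => hx (hsupp x h)
    have h5 : ‖z‖ ≤ ‖(x : ℂ) - z‖ + R := by
      calc ‖z‖ = ‖(x : ℂ) - (x - z)‖ := by simp
        _ ≤ ‖(x : ℂ)‖ + ‖(x : ℂ) - z‖ := norm_sub_le _ _
        _ ≤ _ := by rw [Complex.norm_real, Real.norm_eq_abs]; linarith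
    rw [div_mul_eq_mul_div, one_le_div hz0]
    have : R ≤ R / s * ‖(x : ℂ) - z‖ := by
      rw [div_mul_eq_mul_div, le_div_iff₀ hs]; gcongr
    linarith
  rw [le_div_iff₀ (by positivity)]
  have h3 : ‖cauchyW u z‖ ^ 2 ≤ ((∫ x, |u x|) * (1 / s)) ^ 2 := by gcongr
  have h4 : (‖cauchyW u z‖ * ‖z‖) ^ 2 ≤ ((∫ x, |u x|) * (1 + R / s)) ^ 2 := by
    refine pow_le_pow_left₀ (by positivity) ?_ 2
    rwa [← mul_div_assoc, le_div_iff₀ hz0] at h2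
  nlinarith

theorem differentiableAt_cauchyW {u : ℝ → ℝ} (hu : Integrable u) {z : ℂ} (hz : 0 < z.im) :
    DifferentiableAt ℂ (cauchyW u) z := by
  have hball : ∀ ζ ∈ Metric.ball z (z.im / 2), z.im / 2 ≤ ζ.im := by
    intro ζ hζ
    rw [mem_ball_iff_norm] at hζ
    have := (Complex.abs_im_le_norm (ζ - z)).trans hζ.le
    rw [Complex.sub_im] at this
    linarith [(abs_le.1 this).1]
  refine (hasDerivAt_integral_of_dominated_loc_of_deriv_le
    (F := fun (z : ℂ) (x : ℝ) => (u x : ℂ) * (-Complex.I / (x - z)))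
    (F' := fun (z : ℂ) (x : ℝ) => (u x : ℂ) * (-Complex.I / (x - z) ^ 2))
    (bound := fun x => |u x| * (1 / (z.im / 2) ^ 2))
    (Metric.ball_mem_nhds z (half_pos hz)) ?_ (integrable_cauchyW hu hz) ?_ ?_
    (hu.abs.mul_const _) ?_).2.differentiableAt
  · filter_upwards [Metric.ball_mem_nhds z (half_pos hz)] with ζ hζ
    exact (integrable_cauchyW hu ((half_pos hz).trans_le (hball ζ hζ))).aestronglyMeasurable
  · refine hu.ofReal.aestronglyMeasurable.mul (Continuous.aestronglyMeasurable ?_)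
    exact Continuous.div continuous_const (by fun_prop)
      fun x => pow_ne_zero 2 (ofReal_sub_ne_zero hz x)
  · refine Eventually.of_forall fun x ζ hζ => ?_
    rw [norm_mul, norm_div, norm_neg, Complex.norm_I, Complex.norm_real, Real.norm_eq_abs, norm_pow]
    have := (hball ζ hζ).trans (im_le_norm_ofReal_sub x ζ)
    gcongr
  · refine Eventually.of_forall fun x ζ hζ => ?_
    have h0 := ofReal_sub_ne_zero ((half_pos hz).trans_le (hball ζ hζ)) x
    have h1 : HasDerivAt (fun z : ℂ => (x : ℂ) - z) (-1) ζ := by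
      simpa using (hasDerivAt_id ζ).const_sub (x : ℂ)
    convert! ((hasDerivAt_const ζ (-Complex.I)).div h1 h0).const_mul (u x : ℂ) using 1
    ring

theorem continuous_cauchyW_line {u : ℝ → ℝ} (hu : Integrable u) {s : ℝ} (hs : 0 < s) :
    Continuous fun t : ℝ => cauchyW u (t + s * Complex.I) := by
  have : ContinuousOn (cauchyW u) {z | 0 < z.im} := fun z hz =>
    (differentiableAt_cauchyW hu hz).continuousAt.continuousWithinAt
  exact this.comp_continuous (by fun_prop) (by simp [hs])

theorem neg_I_div_ofReal_sub (x t y : ℝ) :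
    -Complex.I / (x - (t + y * Complex.I)) =
      ((y / ((x - t) ^ 2 + y ^ 2) : ℝ) : ℂ) - ((x - t) / ((x - t) ^ 2 + y ^ 2) : ℝ) * Complex.I := by
  by_cases h : (x - t) ^ 2 + y ^ 2 = 0
  · have h1 : x - t = 0 := by nlinarith [sq_nonneg (x - t), sq_nonneg y]
    have h2 : y = 0 := by nlinarith [sq_nonneg (x - t), sq_nonneg y]
    have h3 : (x : ℂ) = t := by exact_mod_cast sub_eq_zero.1 h1
    simp [h1, h2, h3]
  · have h0 : ((x : ℂ) - (t + y * Complex.I)) ≠ 0 := by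
      intro h0
      apply h
      have := congrArg Complex.normSq h0
      simp [Complex.normSq_apply] at this
      linarith
    have h4 : ((x : ℂ) - t) ^ 2 + (y : ℂ) ^ 2 ≠ 0 := by exact_mod_cast h
    rw [div_eq_iff h0]
    push_cast
    field_simp
    ring_nf
    simp only [Complex.I_sq]
    ring

theorem cauchyW_eq {u : ℝ → ℝ} (hu : Integrable u) (t : ℝ) {y : ℝ} (hy : 0 < y) :
    cauchyW u (t + y * Complex.I) = ((∫ x, u x * (y / ((x - t) ^ 2 + y ^ 2)) : ℝ) : ℂ) -
      ((∫ x, u x * ((x - t) / ((x - t) ^ 2 + y ^ 2)) : ℝ) : ℂ) * Complex.I := by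
  have hint := integrable_cauchyW hu (z := t + y * Complex.I) (by simp [hy])
  have e1 : ∀ p a b : ℝ, ((p : ℂ) * ((a : ℂ) - (b : ℂ) * Complex.I)).re = p * a := by simp
  have e2 : ∀ p a b : ℝ, ((p : ℂ) * ((a : ℂ) - (b : ℂ) * Complex.I)).im = -(p * b) := by simp
  have e3 : ∀ a b : ℝ, ((a : ℂ) - (b : ℂ) * Complex.I).re = a := by simp
  have e4 : ∀ a b : ℝ, ((a : ℂ) - (b : ℂ) * Complex.I).im = -b := by simp
  apply Complex.ext
  · rw [cauchyW, ← RCLike.re_eq_complex_re, ← integral_re hint]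
    simp only [neg_I_div_ofReal_sub, RCLike.re_eq_complex_re, e1, e3]
  · rw [cauchyW, ← RCLike.im_eq_complex_im, ← integral_im hint]
    simp only [neg_I_div_ofReal_sub, RCLike.im_eq_complex_im, e2, e4, integral_neg]

theorem integrable_poissonKernel (x : ℝ) {y : ℝ} (hy : 0 < y) :
    Integrable fun t : ℝ => y / ((x - t) ^ 2 + y ^ 2) := by
  have h := ((integrable_inv_one_add_sq.comp_div hy.ne').comp_sub_right x).const_mul y⁻¹
  refine h.congr (Eventually.of_forall fun t => ?_)
  have : (x - t) ^ 2 + y ^ 2 ≠ 0 := by positivity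
  have : 1 + ((t - x) / y) ^ 2 ≠ 0 := by positivity
  field_simp
  ring

theorem integral_poissonKernel (x : ℝ) {y : ℝ} (hy : 0 < y) :
    ∫ t : ℝ, y / ((x - t) ^ 2 + y ^ 2) = Real.pi := by
  have h : ∀ t : ℝ, y / ((x - t) ^ 2 + y ^ 2) = y⁻¹ * (1 + ((t - x) / y) ^ 2)⁻¹ := by
    intro t
    have : (x - t) ^ 2 + y ^ 2 ≠ 0 := by positivity
    have : 1 + ((t - x) / y) ^ 2 ≠ 0 := by positivity
    field_simp
    ring
  simp_rw [h]
  rw [integral_const_mul, integral_sub_right_eq_self (fun t => (1 + (t / y) ^ 2)⁻¹) x,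
    Measure.integral_comp_div (fun t => (1 + t ^ 2)⁻¹) y, integral_univ_inv_one_add_sq,
    abs_of_pos hy, smul_eq_mul, inv_mul_cancel_left₀ hy.ne']

theorem re_cauchyW_nonneg {u : ℝ → ℝ} (hu : Integrable u) (h0 : ∀ x, 0 ≤ u x) {z : ℂ}
    (hz : 0 < z.im) : 0 ≤ (cauchyW u z).re := by
  have := cauchyW_eq hu z.re hz
  rw [Complex.re_add_im] at this
  rw [this]
  simp only [Complex.sub_re, Complex.ofReal_re, Complex.mul_re, Complex.I_re, mul_zero,
    Complex.ofReal_im, Complex.I_im, mul_one, sub_self, sub_zero]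
  refine integral_nonneg fun x => mul_nonneg (h0 x) (by positivity)

theorem re_cauchyW_eq {u : ℝ → ℝ} (hu : Integrable u) (t : ℝ) {y : ℝ} (hy : 0 < y) :
    (cauchyW u (t + y * Complex.I)).re = ∫ x, u x * (y / ((x - t) ^ 2 + y ^ 2)) := by
  simp [cauchyW_eq hu t hy]

theorem im_cauchyW_eq {u : ℝ → ℝ} (hu : Integrable u) (t : ℝ) {y : ℝ} (hy : 0 < y) :
    (cauchyW u (t + y * Complex.I)).im = -∫ x, u x * ((x - t) / ((x - t) ^ 2 + y ^ 2)) := by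
  simp [cauchyW_eq hu t hy]

theorem integrable_mul_poissonKernel {u : ℝ → ℝ} (hu : Integrable u) {y : ℝ} (hy : 0 < y) :
    Integrable (fun p : ℝ × ℝ => u p.2 * (y / ((p.2 - p.1) ^ 2 + y ^ 2)))
      (volume.prod volume) := by
  have hm : AEStronglyMeasurable (fun p : ℝ × ℝ => u p.2 * (y / ((p.2 - p.1) ^ 2 + y ^ 2)))
      (volume.prod volume) := by
    refine hu.aestronglyMeasurable.comp_snd.mul (Continuous.aestronglyMeasurable ?_)
    exact Continuous.div continuous_const (by fun_prop) fun p => by positivity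
  rw [integrable_prod_iff' hm]
  refine ⟨Eventually.of_forall fun x => (integrable_poissonKernel x hy).const_mul (u x), ?_⟩
  refine (hu.norm.mul_const Real.pi).congr (Eventually.of_forall fun x => ?_)
  simp only [norm_mul]
  rw [integral_const_mul, ← integral_poissonKernel x hy]
  congr 2
  ext t
  exact (Real.norm_of_nonneg (by positivity)).symm

theorem integrable_re_cauchyW {u : ℝ → ℝ} (hu : Integrable u) {y : ℝ} (hy : 0 < y) :
    Integrable fun t : ℝ => (cauchyW u (t + y * Complex.I)).re := by
  simp_rw [re_cauchyW_eq hu _ hy]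
  exact (integrable_mul_poissonKernel hu hy).integral_prod_left

theorem integral_re_cauchyW {u : ℝ → ℝ} (hu : Integrable u) {y : ℝ} (hy : 0 < y) :
    ∫ t : ℝ, (cauchyW u (t + y * Complex.I)).re = (∫ x, u x) * Real.pi := by
  simp_rw [re_cauchyW_eq hu _ hy]
  rw [integral_integral_swap (integrable_mul_poissonKernel hu hy), ← integral_mul_const]
  congr 1
  ext x
  rw [integral_const_mul, integral_poissonKernel x hy]

theorem le_norm_add_ofReal {w : ℂ} (hw : 0 ≤ w.re) (l : ℝ) : l ≤ ‖w + l‖ := by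
  refine le_trans ?_ (Complex.re_le_norm _)
  simp [hw]

theorem norm_div_add_ofReal_le_one {w : ℂ} (hw : 0 ≤ w.re) {l : ℝ} (hl : 0 < l) :
    ‖w / (w + l)‖ ≤ 1 := by
  rw [norm_div]
  refine div_le_one_of_le₀ ?_ (norm_nonneg _)
  rw [← sq_le_sq₀ (norm_nonneg _) (norm_nonneg _), Complex.sq_norm, Complex.sq_norm,
    Complex.normSq_apply, Complex.normSq_apply]
  simp only [Complex.add_re, Complex.ofReal_re, Complex.add_im, Complex.ofReal_im, add_zero]
  nlinarith [mul_nonneg hw hl.le]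

theorem re_div_add_ofReal (w : ℂ) (l : ℝ) :
    (w / (w + l)).re = (w.re ^ 2 + w.im ^ 2 + l * w.re) / ((w.re + l) ^ 2 + w.im ^ 2) := by
  rw [Complex.div_re]
  simp only [Complex.normSq_apply, Complex.add_re, Complex.ofReal_re, Complex.add_im,
    Complex.ofReal_im, add_zero]
  rw [← add_div]
  congr 1 <;> ring

theorem re_div_add_ofReal_nonneg {w : ℂ} (hw : 0 ≤ w.re) {l : ℝ} (hl : 0 < l) :
    0 ≤ (w / (w + l)).re := by
  rw [re_div_add_ofReal]; positivity

theorem half_le_re_div_add_ofReal {w : ℂ} (hw : 0 ≤ w.re) {l : ℝ} (hl : 0 < l) (h : l ≤ ‖w‖) :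
    1 / 2 ≤ (w / (w + l)).re := by
  have h2 : l ^ 2 ≤ w.re ^ 2 + w.im ^ 2 := by
    have : l ^ 2 ≤ ‖w‖ ^ 2 := by gcongr
    rw [Complex.sq_norm, Complex.normSq_apply] at this
    linarith
  rw [re_div_add_ofReal, div_le_div_iff₀ (by norm_num) (by positivity)]
  nlinarith

theorem integrable_and_integral_re_div {u : ℝ → ℝ} (hu : Integrable u) (h0 : ∀ x, 0 ≤ u x) {R : ℝ}
    (hR : 0 ≤ R) (hsupp : ∀ x, R < |x| → u x = 0) {s l : ℝ} (hs : 0 < s) (hl : 0 < l) :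
    (Integrable fun t : ℝ =>
      (cauchyW u (t + s * Complex.I) / (cauchyW u (t + s * Complex.I) + l)).re) ∧
    ∫ t : ℝ, (cauchyW u (t + s * Complex.I) / (cauchyW u (t + s * Complex.I) + l)).re =
      (∫ x, u x) * Real.pi / l := by
  have hpos : ∀ z : ℂ, s ≤ z.im → 0 ≤ (cauchyW u z).re := fun z hz =>
    re_cauchyW_nonneg hu h0 (hs.trans_le hz)
  have hne : ∀ z : ℂ, s ≤ z.im → cauchyW u z + l ≠ 0 := fun z hz =>
    norm_pos_iff.1 (hl.trans_le (le_norm_add_ofReal (hpos z hz) l))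
  obtain ⟨hi, hz⟩ := integral_horizontal_line_eq_zero
    (H := fun z => cauchyW u z ^ 2 / (cauchyW u z + l)) (s := s)
    (C := (∫ x, |u x|) ^ 2 * ((1 / s) ^ 2 + (1 + R / s) ^ 2) / l) hs.le
    (fun z hz => by
      have := differentiableAt_cauchyW hu (hs.trans_le hz)
      exact ((this.pow 2).div (this.add_const _) (hne z hz)).differentiableWithinAt)
    (fun z hz => by
      rw [norm_div, norm_pow, div_right_comm]
      exact div_le_div₀ (by positivity) (norm_cauchyW_sq_le hu hs hR hsupp hz) hl
        (le_norm_add_ofReal (hpos z hz) l))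
  have e : ∀ t : ℝ, (cauchyW u (t + s * Complex.I) / (cauchyW u (t + s * Complex.I) + l)).re =
      l⁻¹ * ((cauchyW u (t + s * Complex.I)).re -
        RCLike.re (cauchyW u (t + s * Complex.I) ^ 2 / (cauchyW u (t + s * Complex.I) + l))) := by
    intro t
    rw [RCLike.re_eq_complex_re, ← Complex.sub_re, ← Complex.re_ofReal_mul]
    congr 1
    have h1 := hne (t + s * Complex.I) (by simp)
    have h2 : (l : ℂ) ≠ 0 := by exact_mod_cast hl.ne'
    rw [Complex.ofReal_inv]
    field_simp
    ring
  have hi1 := integrable_re_cauchyW hu hs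
  simp_rw [e]
  refine ⟨(hi1.sub hi.re).const_mul _, ?_⟩
  rw [integral_const_mul, integral_sub hi1 hi.re, integral_re_cauchyW hu hs, integral_re hi, hz]
  simp only [map_zero, sub_zero]
  field_simp

theorem poisson_of_norm_le_one {G : ℂ → ℂ} {s y : ℝ} (hs : 0 ≤ s) (hy : 0 < y)
    (hd : DifferentiableOn ℂ G {z | s ≤ z.im}) (hb : ∀ z : ℂ, s ≤ z.im → ‖G z‖ ≤ 1) (x : ℝ) :
    ∫ t : ℝ, ((y / ((x - t) ^ 2 + y ^ 2) : ℝ) : ℂ) * G (t + s * Complex.I) =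
      Real.pi * G (x + (s + y : ℝ) * Complex.I) := by
  set z : ℂ := x + (s + y : ℝ) * Complex.I with hz
  set z' : ℂ := x + (s - y : ℝ) * Complex.I with hz'
  have hzim : z.im = s + y := by simp [hz]
  have hz'im : z'.im = s - y := by simp [hz']
  have hzmem : s ≤ z.im := by rw [hzim]; linarith
  have hnhds : {w : ℂ | s ≤ w.im} ∈ nhds z := by
    refine mem_of_superset ((isOpen_lt continuous_const Complex.continuous_im).mem_nhds
      (show s < z.im by rw [hzim]; linarith)) fun w hw => (le_of_lt hw : s ≤ w.im)
  have hds : DifferentiableOn ℂ (dslope G z) {w | s ≤ w.im} :=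
    (Complex.differentiableOn_dslope hnhds).2 hd
  have hsub' : ∀ w : ℂ, s ≤ w.im → y ≤ ‖w - z'‖ := fun w hw => by
    refine le_trans ?_ ((le_abs_self _).trans (Complex.abs_im_le_norm _))
    rw [Complex.sub_im, hz'im]; linarith
  have hrefl : ∀ w : ℂ, s ≤ w.im → ‖w - z‖ ≤ ‖w - z'‖ := fun w hw => by
    rw [← sq_le_sq₀ (norm_nonneg _) (norm_nonneg _), Complex.sq_norm, Complex.sq_norm,
      Complex.normSq_apply, Complex.normSq_apply]
    simp only [Complex.sub_im, hz'im, hzim, Complex.sub_re]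
    have : z.re = z'.re := by simp [hz, hz']
    rw [this]
    nlinarith
  have hsubset : Metric.closedBall z (y / 2) ⊆ {w : ℂ | s ≤ w.im} := fun w hw => by
    have := (Complex.abs_im_le_norm (w - z)).trans (mem_closedBall_iff_norm.1 hw)
    rw [Complex.sub_im, hzim] at this
    have := (abs_le.1 this).1
    show s ≤ w.im
    linarith
  obtain ⟨C, hC⟩ := (isCompact_closedBall z (y / 2)).exists_bound_of_continuousOn
    (hds.continuousOn.mono hsubset)
  have hC0 : 0 ≤ C := (norm_nonneg _).trans (hC z (Metric.mem_closedBall_self (by positivity)))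
  have hdiv : ∀ w : ℂ, s ≤ w.im → w - z' ≠ 0 := fun w hw =>
    norm_pos_iff.1 (hy.trans_le (hsub' w hw))
  obtain ⟨hi, h0⟩ := integral_horizontal_line_eq_zero
    (H := fun w => dslope G z w / (w - z')) (s := s)
    (C := C / y * (1 + (‖z‖ + y) ^ 2) + 2 * ((2 / y) ^ 2 + (1 + 2 * ‖z‖ / y) ^ 2)) hs
    (hds.div (by fun_prop) hdiv)
    (fun w hw => by
      rw [le_div_iff₀ (by positivity), norm_div]
      by_cases hwb : w ∈ Metric.closedBall z (y / 2)
      · refine le_add_of_le_of_nonneg ?_ (by positivity)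
        have h1 := hC w hwb
        have h2 := hsub' w hw
        have h3 : ‖w‖ ≤ ‖z‖ + y := by
          have := norm_le_norm_add_norm_sub' w z
          have := mem_closedBall_iff_norm.1 hwb
          linarith
        gcongr
      · refine le_add_of_nonneg_of_le (by positivity) ?_
        rw [mem_closedBall_iff_norm, not_le] at hwb
        have hwz : w ≠ z := by
          rintro rfl
          rw [sub_self, norm_zero] at hwb
          linarith
        have hpos : 0 < ‖w - z‖ := lt_trans (by positivity) hwb
        have hA : 1 ≤ ‖w - z‖ * (2 / y) := by
          rw [mul_div_assoc', one_le_div hy]; linarith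
        have hB : ‖w‖ ≤ ‖w - z‖ * (1 + 2 * ‖z‖ / y) := by
          have := norm_le_norm_add_norm_sub' w z
          have := mul_le_mul_of_nonneg_left hA (norm_nonneg z)
          calc ‖w‖ ≤ ‖z‖ * (‖w - z‖ * (2 / y)) + ‖w - z‖ := by linarith
            _ = _ := by ring
        have h1 : ‖dslope G z w‖ ≤ 2 / ‖w - z‖ := by
          rw [dslope_of_ne _ hwz, slope_def_field, norm_div]
          gcongr
          exact (norm_sub_le _ _).trans (by linarith [hb w hw, hb z hzmem])
        have h2 := hrefl w hw
        calc ‖dslope G z w‖ / ‖w - z'‖ * (1 + ‖w‖ ^ 2)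
            ≤ 2 / ‖w - z‖ / ‖w - z‖ *
              ((‖w - z‖ * (2 / y)) ^ 2 + (‖w - z‖ * (1 + 2 * ‖z‖ / y)) ^ 2) := by
              gcongr
              nlinarith
          _ = 2 * ((2 / y) ^ 2 + (1 + 2 * ‖z‖ / y) ^ 2) := by
              field_simp)
  have hcont : Continuous fun t : ℝ => G (t + s * Complex.I) :=
    hd.continuousOn.comp_continuous (by fun_prop) (by simp)
  have hP : Integrable fun t : ℝ => ((y / ((x - t) ^ 2 + y ^ 2) : ℝ) : ℂ) :=
    (integrable_poissonKernel x hy).ofReal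
  have hG : Integrable fun t : ℝ =>
      ((y / ((x - t) ^ 2 + y ^ 2) : ℝ) : ℂ) * G (t + s * Complex.I) :=
    hP.mul_bdd (c := 1) hcont.aestronglyMeasurable (Eventually.of_forall fun t => hb _ (by simp))
  have e : ∀ t : ℝ, (y : ℂ) * (dslope G z (t + s * Complex.I) / (t + s * Complex.I - z')) =
      ((y / ((x - t) ^ 2 + y ^ 2) : ℝ) : ℂ) * G (t + s * Complex.I) -
      ((y / ((x - t) ^ 2 + y ^ 2) : ℝ) : ℂ) * G z := by
    intro t
    have hne : (t + s * Complex.I : ℂ) ≠ z := by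
      intro h
      have := congrArg Complex.im h
      rw [hzim] at this
      simp at this
      exact hy.ne' this
    rw [dslope_of_ne _ hne, slope_def_field, ← mul_sub]
    have h1 := sub_ne_zero.2 hne
    have h2 := hdiv (t + s * Complex.I) (by simp)
    have h3 : ((x : ℂ) - t) ^ 2 + (y : ℂ) ^ 2 ≠ 0 := by
      have : (x - t) ^ 2 + y ^ 2 ≠ 0 := by positivity
      exact_mod_cast this
    have h4 : (t + s * Complex.I - z) * (t + s * Complex.I - z') =
        ((x : ℂ) - t) ^ 2 + (y : ℂ) ^ 2 := by
      rw [hz, hz']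
      push_cast
      ring_nf
      simp only [Complex.I_sq]
      ring
    push_cast
    rw [← h4, div_div]
    ring
  have h5 : ∫ t : ℝ, (y : ℂ) * (dslope G z (t + s * Complex.I) / (t + s * Complex.I - z')) = 0 := by
    rw [integral_const_mul, h0, mul_zero]
  simp_rw [e] at h5
  rw [integral_sub hG (hP.mul_const _), integral_mul_const, sub_eq_zero] at h5
  rw [h5, integral_complex_ofReal, integral_poissonKernel x hy]

theorem half_pi_le_integral_poisson {u : ℝ → ℝ} (hu : Integrable u) (h0 : ∀ x, 0 ≤ u x)
    {s l y : ℝ} (hs : 0 < s) (hl : 0 < l) (hy : 0 < y) (x : ℝ)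
    (h : l ≤ ‖cauchyW u (x + (s + y : ℝ) * Complex.I)‖) :
    Real.pi / 2 ≤ ∫ t : ℝ, y / ((x - t) ^ 2 + y ^ 2) *
      (cauchyW u (t + s * Complex.I) / (cauchyW u (t + s * Complex.I) + l)).re := by
  have hpos : ∀ z : ℂ, s ≤ z.im → 0 ≤ (cauchyW u z).re := fun z hz =>
    re_cauchyW_nonneg hu h0 (hs.trans_le hz)
  have hne : ∀ z : ℂ, s ≤ z.im → cauchyW u z + l ≠ 0 := fun z hz =>
    norm_pos_iff.1 (hl.trans_le (le_norm_add_ofReal (hpos z hz) l))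
  have hd : DifferentiableOn ℂ (fun z => cauchyW u z / (cauchyW u z + l)) {z | s ≤ z.im} :=
    fun z hz => by
      have := differentiableAt_cauchyW hu (hs.trans_le hz)
      exact (this.div (this.add_const _) (hne z hz)).differentiableWithinAt
  have key := poisson_of_norm_le_one hs.le hy hd
    (fun z hz => norm_div_add_ofReal_le_one (hpos z hz) hl) x
  have hcont : Continuous fun t : ℝ =>
      cauchyW u (t + s * Complex.I) / (cauchyW u (t + s * Complex.I) + l) :=
    hd.continuousOn.comp_continuous (by fun_prop) (by simp)
  have hP : Integrable fun t : ℝ => ((y / ((x - t) ^ 2 + y ^ 2) : ℝ) : ℂ) :=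
    (integrable_poissonKernel x hy).ofReal
  have hG := hP.mul_bdd (c := 1) hcont.aestronglyMeasurable
    (Eventually.of_forall fun t => norm_div_add_ofReal_le_one (hpos _ (by simp)) hl)
  have h1 := congrArg RCLike.re key
  rw [← integral_re hG] at h1
  simp only [RCLike.re_eq_complex_re, Complex.re_ofReal_mul] at h1
  rw [h1]
  have := half_le_re_div_add_ofReal (hpos (x + (s + y : ℝ) * Complex.I) (by simp [hy.le])) hl h
  nlinarith [Real.pi_pos]

/-- Weak type `(1,1)` estimate for the Hardy-Littlewood maximal function on `ℝ`. -/
theorem volume_maximal_le {φ : ℝ → ℝ≥0∞} (hφ : ∫⁻ t, φ t ≠ ⊤) {l : ℝ} (hl : 0 < l) :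
    volume {x : ℝ | ∃ r > 0, ENNReal.ofReal (l * r) ≤ ∫⁻ t in Metric.closedBall x r, φ t} ≤
      10 * (∫⁻ t, φ t) / ENNReal.ofReal l := by
  set A := {x : ℝ | ∃ r > 0, ENNReal.ofReal (l * r) ≤ ∫⁻ t in Metric.closedBall x r, φ t} with hA
  have : ∀ x : ℝ, ∃ r : ℝ, x ∈ A → (0 < r ∧
      ENNReal.ofReal (l * r) ≤ ∫⁻ t in Metric.closedBall x r, φ t) := by
    intro x
    by_cases hx : x ∈ A
    · obtain ⟨r, hr, h⟩ := hx
      exact ⟨r, fun _ => ⟨hr, h⟩⟩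
    · exact ⟨0, fun h => absurd h hx⟩
  choose r hr using this
  obtain ⟨U, hUA, hdisj, hcov⟩ := Vitali.exists_disjoint_subfamily_covering_enlargement_closedBall
    A (fun x => x) r ((∫⁻ t, φ t).toReal / l) (fun x hx => by
      rw [le_div_iff₀ hl, mul_comm]
      refine (ENNReal.ofReal_le_iff_le_toReal hφ).1 ((hr x hx).2.trans ?_)
      exact setLIntegral_le_lintegral _ _) 5 (by norm_num)
  have hUc : U.Countable := by
    refine hdisj.countable_of_nonempty_interior fun x hx => ?_
    refine ⟨x, ?_⟩
    rw [mem_interior_iff_mem_nhds]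
    exact Metric.closedBall_mem_nhds x (hr x (hUA hx)).1
  have hsub : A ⊆ ⋃ x ∈ U, Metric.closedBall x (5 * r x) := by
    intro x hx
    obtain ⟨b, hb, hxb⟩ := hcov x hx
    exact mem_biUnion hb (hxb (Metric.mem_closedBall_self (hr x hx).1.le))
  have := hUc.to_subtype
  calc volume A ≤ volume (⋃ x ∈ U, Metric.closedBall x (5 * r x)) := measure_mono hsub
    _ ≤ ∑' x : U, volume (Metric.closedBall (x : ℝ) (5 * r x)) := measure_biUnion_le _ hUc _
    _ ≤ ∑' x : U, 10 / ENNReal.ofReal l * ∫⁻ t in Metric.closedBall (x : ℝ) (r x), φ t := by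
      refine ENNReal.tsum_le_tsum fun x => ?_
      have hx := hr x (hUA x.2)
      rw [Real.volume_closedBall]
      calc ENNReal.ofReal (2 * (5 * r x))
          = 10 / ENNReal.ofReal l * ENNReal.ofReal (l * r x) := by
            rw [show (10 : ℝ≥0∞) = ENNReal.ofReal 10 by norm_num, ← ENNReal.ofReal_div_of_pos hl,
              ← ENNReal.ofReal_mul (by positivity)]
            congr 1
            field_simp
            ring
        _ ≤ _ := by gcongr; exact hx.2
    _ = 10 / ENNReal.ofReal l * ∫⁻ t in ⋃ x ∈ U, Metric.closedBall (x : ℝ) (r x), φ t := by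
      rw [ENNReal.tsum_mul_left, lintegral_biUnion hUc (fun x _ => measurableSet_closedBall) hdisj]
    _ ≤ 10 / ENNReal.ofReal l * ∫⁻ t, φ t :=
      mul_le_mul_right (setLIntegral_le_lintegral _ _) _
    _ = _ := by rw [ENNReal.mul_div_right_comm]

theorem poissonKernel_le_tsum (x t : ℝ) {y : ℝ} (hy : 0 < y) :
    ENNReal.ofReal (y / ((x - t) ^ 2 + y ^ 2)) ≤
      ∑' k : ℕ, ENNReal.ofReal (4 / 4 ^ k / y) *
        (Metric.closedBall x (2 ^ k * y)).indicator (fun _ => 1) t := by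
  have hex : ∃ k : ℕ, |x - t| ≤ 2 ^ k * y := by
    obtain ⟨k, hk⟩ := pow_unbounded_of_one_lt (|x - t| / y) (one_lt_two)
    exact ⟨k, ((div_lt_iff₀ hy).1 hk).le⟩
  classical
  set k := Nat.find hex with hk
  have h1 : |x - t| ≤ 2 ^ k * y := Nat.find_spec hex
  refine le_trans ?_ (ENNReal.le_tsum k)
  rw [indicator_of_mem (by rw [Metric.mem_closedBall', Real.dist_eq]; exact h1), mul_one]
  refine ENNReal.ofReal_le_ofReal ?_
  rw [div_div, div_le_div_iff₀ (by positivity) (by positivity), ← sq_abs (x - t)]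
  rcases Nat.eq_zero_or_pos k with h0 | h0
  · rw [h0, pow_zero, one_mul]
    nlinarith [sq_nonneg |x - t|]
  · have h2 : 2 ^ (k - 1) * y < |x - t| := not_le.1 (Nat.find_min hex (Nat.sub_lt h0 one_pos))
    have h3 : (2 : ℝ) ^ k = 2 * 2 ^ (k - 1) := by
      rw [← pow_succ', Nat.sub_add_cancel h0]
    have h4 : (4 : ℝ) ^ k = (2 ^ k) ^ 2 := by
      rw [← pow_mul, mul_comm, pow_mul]; norm_num
    have h5 : (2 ^ (k - 1) * y) ^ 2 ≤ |x - t| ^ 2 := by gcongr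
    rw [h4, h3]
    nlinarith

theorem lintegral_poisson_le {φ : ℝ → ℝ≥0∞} (hφ : Measurable φ) {x y c : ℝ} (hy : 0 < y)
    (hc : 0 ≤ c)
    (h : ∀ r > 0, ∫⁻ t in Metric.closedBall x r, φ t ≤ ENNReal.ofReal (c * r)) :
    ∫⁻ t, ENNReal.ofReal (y / ((x - t) ^ 2 + y ^ 2)) * φ t ≤ ENNReal.ofReal (8 * c) := by
  calc ∫⁻ t, ENNReal.ofReal (y / ((x - t) ^ 2 + y ^ 2)) * φ t
      ≤ ∫⁻ t, ∑' k : ℕ, ENNReal.ofReal (4 / 4 ^ k / y) *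
        (Metric.closedBall x (2 ^ k * y)).indicator φ t := by
        refine lintegral_mono fun t => ?_
        refine (mul_le_mul_left (poissonKernel_le_tsum x t hy) _).trans (le_of_eq ?_)
        rw [← ENNReal.tsum_mul_right]
        congr 1
        ext k
        by_cases ht : t ∈ Metric.closedBall x (2 ^ k * y) <;> simp [ht]
    _ = ∑' k : ℕ, ENNReal.ofReal (4 / 4 ^ k / y) *
        ∫⁻ t in Metric.closedBall x (2 ^ k * y), φ t := by
        rw [lintegral_tsum fun k =>
          ((hφ.indicator measurableSet_closedBall).const_mul _).aemeasurable]
        congr 1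
        ext k
        rw [lintegral_const_mul _ (hφ.indicator measurableSet_closedBall),
          lintegral_indicator measurableSet_closedBall]
    _ ≤ ∑' k : ℕ, ENNReal.ofReal (4 * c * (1 / 2) ^ k) := by
        refine ENNReal.tsum_le_tsum fun k => ?_
        refine (mul_le_mul_right (h _ (by positivity)) _).trans (le_of_eq ?_)
        rw [← ENNReal.ofReal_mul (by positivity)]
        congr 1
        have h4 : (4 : ℝ) ^ k = 2 ^ k * 2 ^ k := by rw [← mul_pow]; norm_num
        rw [h4, one_div, inv_pow]
        field_simp
    _ = ENNReal.ofReal (8 * c) := by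
        rw [← ENNReal.ofReal_tsum_of_nonneg (fun k => by positivity)
          (summable_geometric_two.mul_left _), tsum_mul_left, tsum_geometric_two]
        congr 1
        ring

theorem volume_cauchyW_ge_le_of_lt {u : ℝ → ℝ} (hu : Integrable u) (h0 : ∀ x, 0 ≤ u x) {R : ℝ}
    (hR : 0 ≤ R) (hsupp : ∀ x, R < |x| → u x = 0) {s l : ℝ} (hs : 0 < s) (hl : 0 < l) :
    volume {x : ℝ | ∃ y : ℝ, s < y ∧ l ≤ ‖cauchyW u (x + y * Complex.I)‖} ≤
      ENNReal.ofReal (200 * (∫ x, u x) / l) := by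
  set g : ℝ → ℝ := fun t =>
    (cauchyW u (t + s * Complex.I) / (cauchyW u (t + s * Complex.I) + l)).re with hg
  obtain ⟨hgi, hgint⟩ := integrable_and_integral_re_div hu h0 hR hsupp hs hl
  have hg0 : ∀ t, 0 ≤ g t := fun t =>
    re_div_add_ofReal_nonneg (re_cauchyW_nonneg hu h0 (by simp [hs])) hl
  have hgc : Continuous g := by
    have hc := continuous_cauchyW_line hu hs
    refine Complex.continuous_re.comp (hc.div (hc.add continuous_const) fun t => ?_)
    exact norm_pos_iff.1 (hl.trans_le
      (le_norm_add_ofReal (re_cauchyW_nonneg hu h0 (by simp [hs])) l))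
  have hgl : ∫⁻ t, ENNReal.ofReal (g t) = ENNReal.ofReal ((∫ x, u x) * Real.pi / l) := by
    rw [← ofReal_integral_eq_lintegral_ofReal hgi (Eventually.of_forall hg0), hgint]
  have hsub : {x : ℝ | ∃ y : ℝ, s < y ∧ l ≤ ‖cauchyW u (x + y * Complex.I)‖} ⊆
      {x : ℝ | ∃ r > 0, ENNReal.ofReal (Real.pi / 17 * r) ≤
        ∫⁻ t in Metric.closedBall x r, ENNReal.ofReal (g t)} := by
    rintro x ⟨y, hys, hxy⟩
    by_contra hcon
    simp only [mem_ofPred_eq, not_exists, not_and, not_le] at hcon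
    have h1 := lintegral_poisson_le (φ := fun t => ENNReal.ofReal (g t)) (x := x) (y := y - s)
      (c := Real.pi / 17)
      hgc.measurable.ennreal_ofReal (sub_pos.2 hys) (by positivity) (fun r hr => (hcon r hr).le)
    have h2 := half_pi_le_integral_poisson hu h0 hs hl (sub_pos.2 hys) x
      (by rwa [add_sub_cancel])
    have hint : Integrable fun t : ℝ => (y - s) / ((x - t) ^ 2 + (y - s) ^ 2) * g t := by
      refine (integrable_poissonKernel x (sub_pos.2 hys)).mul_bdd (c := 1)
        hgc.aestronglyMeasurable (Eventually.of_forall fun t => ?_)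
      rw [Real.norm_eq_abs]
      exact (Complex.abs_re_le_norm _).trans (norm_div_add_ofReal_le_one
        (re_cauchyW_nonneg hu h0 (by simp [hs])) hl)
    have hys' := sub_pos.2 hys
    have h3 : ∫⁻ t, ENNReal.ofReal ((y - s) / ((x - t) ^ 2 + (y - s) ^ 2)) * ENNReal.ofReal (g t) =
        ENNReal.ofReal (∫ t, (y - s) / ((x - t) ^ 2 + (y - s) ^ 2) * g t) := by
      rw [ofReal_integral_eq_lintegral_ofReal hint
        (Eventually.of_forall fun t => mul_nonneg (by positivity) (hg0 t))]
      congr 1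
      ext t
      rw [ENNReal.ofReal_mul (by positivity)]
    rw [h3, ENNReal.ofReal_le_ofReal_iff (by positivity)] at h1
    have := h2.trans h1
    linarith [Real.pi_pos]
  refine (measure_mono hsub).trans ((volume_maximal_le (by rw [hgl]; exact ENNReal.ofReal_ne_top)
    (by positivity)).trans ?_)
  have hM : 0 ≤ ∫ x, u x := integral_nonneg h0
  rw [hgl, show (10 : ℝ≥0∞) = ENNReal.ofReal 10 by norm_num, ← ENNReal.ofReal_mul (by norm_num),
    ← ENNReal.ofReal_div_of_pos (by positivity)]
  refine ENNReal.ofReal_le_ofReal ?_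
  have : 10 * ((∫ x, u x) * Real.pi / l) / (Real.pi / 17) = 170 * (∫ x, u x) / l := by
    field_simp
    ring
  rw [this]
  gcongr
  norm_num

theorem volume_cauchyW_ge_le {u : ℝ → ℝ} (hu : Integrable u) (h0 : ∀ x, 0 ≤ u x) {R : ℝ}
    (hR : 0 ≤ R) (hsupp : ∀ x, R < |x| → u x = 0) {l : ℝ} (hl : 0 < l) :
    volume {x : ℝ | ∃ y : ℝ, 0 < y ∧ l ≤ ‖cauchyW u (x + y * Complex.I)‖} ≤
      ENNReal.ofReal (200 * (∫ x, u x) / l) := by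
  have hU : {x : ℝ | ∃ y : ℝ, 0 < y ∧ l ≤ ‖cauchyW u (x + y * Complex.I)‖} =
      ⋃ n : ℕ, {x : ℝ | ∃ y : ℝ, 1 / ((n : ℝ) + 1) < y ∧ l ≤ ‖cauchyW u (x + y * Complex.I)‖} := by
    ext x
    simp only [mem_ofPred_eq, mem_iUnion]
    constructor
    · rintro ⟨y, hy, h⟩
      obtain ⟨n, hn⟩ := exists_nat_one_div_lt hy
      exact ⟨n, y, hn, h⟩
    · rintro ⟨n, y, hy, h⟩
      exact ⟨y, lt_trans (by positivity) hy, h⟩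
  have hmono : Monotone fun n : ℕ =>
      {x : ℝ | ∃ y : ℝ, 1 / ((n : ℝ) + 1) < y ∧ l ≤ ‖cauchyW u (x + y * Complex.I)‖} := by
    rintro m n hmn x ⟨y, hy, h⟩
    refine ⟨y, lt_of_le_of_lt ?_ hy, h⟩
    have : (m : ℝ) ≤ n := by exact_mod_cast hmn
    gcongr
  rw [hU, hmono.measure_iUnion]
  exact iSup_le fun n => volume_cauchyW_ge_le_of_lt hu h0 hR hsupp (by positivity) hl

/-- The kernel `1/s`, truncated to `|s| > ε`. -/
noncomputable def truncKernel (ε s : ℝ) : ℝ := if ε < |s| then s⁻¹ else 0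

theorem measurable_truncKernel (ε : ℝ) : Measurable (truncKernel ε) :=
  Measurable.ite (measurableSet_lt measurable_const continuous_abs.measurable)
    measurable_inv measurable_const

theorem abs_truncKernel_le {ε : ℝ} (hε : 0 < ε) (s : ℝ) : |truncKernel ε s| ≤ ε⁻¹ := by
  unfold truncKernel
  split_ifs with h
  · rw [abs_inv]
    exact inv_anti₀ hε h.le
  · simpa using hε.le

theorem truncKernel_neg (ε s : ℝ) : truncKernel ε (-s) = -truncKernel ε s := by
  unfold truncKernel
  split_ifs with h1 h2 h2 <;> simp_all [inv_neg]

theorem abs_truncKernel_sub_le {ε : ℝ} (hε : 0 < ε) (s : ℝ) :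
    |truncKernel ε s - s / (s ^ 2 + ε ^ 2)| ≤ ε / (s ^ 2 + ε ^ 2) := by
  unfold truncKernel
  split_ifs with h
  · have hs : s ≠ 0 := abs_pos.1 (hε.trans h)
    have : s⁻¹ - s / (s ^ 2 + ε ^ 2) = ε / (s ^ 2 + ε ^ 2) * (ε / s) := by
      field_simp
      ring
    rw [this, abs_mul, abs_of_pos (by positivity : 0 < ε / (s ^ 2 + ε ^ 2)), abs_div,
      abs_of_pos hε]
    exact mul_le_of_le_one_right (by positivity) ((div_le_one (hε.trans h)).2 h.le)
  · rw [zero_sub, abs_neg, abs_div, abs_of_pos (by positivity : 0 < s ^ 2 + ε ^ 2)]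
    gcongr
    exact not_lt.1 h

/-- The truncated Hilbert transform of the restriction of `u` to `(-1, 1)`, without the
factor `1/π`. -/
noncomputable def truncT (ε : ℝ) (u : ℝ → ℂ) (t : ℝ) : ℂ :=
  ∫ x, u x * (truncKernel ε (x - t) : ℂ) ∂mIoo

theorem integrable_mul_truncKernel {μ : Measure ℝ} {u : ℝ → ℂ} (hu : Integrable u μ) {ε : ℝ}
    (hε : 0 < ε) (t : ℝ) : Integrable (fun x => u x * (truncKernel ε (x - t) : ℂ)) μ := by
  refine hu.mul_bdd (c := ε⁻¹) ?_ (Eventually.of_forall fun x => ?_)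
  · exact (Complex.measurable_ofReal.comp
      ((measurable_truncKernel ε).comp (measurable_id.sub_const t))).aestronglyMeasurable
  · rw [Complex.norm_real]
    exact abs_truncKernel_le hε _

theorem truncT_add {u v : ℝ → ℂ} (hu : Integrable u mIoo) (hv : Integrable v mIoo) {ε : ℝ}
    (hε : 0 < ε) (t : ℝ) : truncT ε (fun x => u x + v x) t = truncT ε u t + truncT ε v t := by
  unfold truncT
  rw [← integral_add (integrable_mul_truncKernel hu hε t) (integrable_mul_truncKernel hv hε t)]
  simp_rw [add_mul]

theorem truncT_const_mul (c : ℂ) (u : ℝ → ℂ) (ε t : ℝ) :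
    truncT ε (fun x => c * u x) t = c * truncT ε u t := by
  unfold truncT
  rw [← integral_const_mul]
  simp_rw [mul_assoc]

theorem truncT_congr {u v : ℝ → ℂ} (h : u =ᵐ[mIoo] v) (ε t : ℝ) : truncT ε u t = truncT ε v t :=
  integral_congr_ae (h.mono fun x hx => by simp only [hx])

theorem truncT_ofReal (u : ℝ → ℝ) (ε t : ℝ) :
    truncT ε (fun x => (u x : ℂ)) t = ((∫ x, u x * truncKernel ε (x - t) ∂mIoo : ℝ) : ℂ) := by
  rw [← integral_complex_ofReal]
  unfold truncT
  simp_rw [Complex.ofReal_mul]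

theorem abs_integral_truncKernel_add_im_le {u : ℝ → ℝ} (hu : Integrable u) (h0 : ∀ x, 0 ≤ u x)
    {ε : ℝ} (hε : 0 < ε) (t : ℝ) :
    |(∫ x, u x * truncKernel ε (x - t)) + (cauchyW u (t + ε * Complex.I)).im| ≤
      (cauchyW u (t + ε * Complex.I)).re := by
  have i1 : Integrable fun x => u x * truncKernel ε (x - t) := by
    refine hu.mul_bdd (c := ε⁻¹) ?_ (Eventually.of_forall fun x => abs_truncKernel_le hε _)
    exact ((measurable_truncKernel ε).comp (measurable_id.sub_const t)).aestronglyMeasurable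
  have hc : ∀ x : ℝ, (x - t) ^ 2 + ε ^ 2 ≠ 0 := fun x => by positivity
  have i3 : Integrable fun x => u x * (ε / ((x - t) ^ 2 + ε ^ 2)) := by
    refine hu.mul_bdd (c := ε⁻¹) ?_ (Eventually.of_forall fun x => ?_)
    · exact (Continuous.div continuous_const (by fun_prop) hc).aestronglyMeasurable
    · rw [Real.norm_eq_abs, abs_of_nonneg (by positivity), inv_eq_one_div,
        div_le_div_iff₀ (by positivity) hε]
      nlinarith [sq_nonneg (x - t)]
  have i2 : Integrable fun x => u x * ((x - t) / ((x - t) ^ 2 + ε ^ 2)) := by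
    refine hu.mul_bdd (c := ε⁻¹) ?_ (Eventually.of_forall fun x => ?_)
    · exact (Continuous.div (by fun_prop) (by fun_prop) hc).aestronglyMeasurable
    · rw [Real.norm_eq_abs, abs_div, abs_of_pos (by positivity : 0 < (x - t) ^ 2 + ε ^ 2),
        inv_eq_one_div, div_le_div_iff₀ (by positivity) hε, ← sq_abs (x - t)]
      nlinarith [sq_nonneg (|x - t| - ε), sq_nonneg |x - t|, abs_nonneg (x - t)]
  rw [im_cauchyW_eq hu t hε, re_cauchyW_eq hu t hε, ← sub_eq_add_neg, ← integral_sub i1 i2]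
  refine (abs_integral_le_integral_abs).trans (integral_mono (i1.sub i2).abs i3 fun x => ?_)
  simp only
  rw [← mul_sub, abs_mul, abs_of_nonneg (h0 x)]
  exact mul_le_mul_of_nonneg_left (abs_truncKernel_sub_le hε _) (h0 x)

theorem integrable_indicator_mIoo {u : ℝ → ℝ} (hu : Integrable u mIoo) :
    Integrable ((Ioo (-1 : ℝ) 1).indicator u) :=
  (integrable_indicator_iff measurableSet_Ioo).2 hu

theorem integral_mIoo {E : Type*} [NormedAddCommGroup E] [NormedSpace ℝ E] (u : ℝ → E) :
    ∫ x, u x ∂mIoo = ∫ x, (Ioo (-1 : ℝ) 1).indicator u x :=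
  (integral_indicator measurableSet_Ioo).symm

theorem norm_truncT_ofReal_le {u : ℝ → ℝ} (hu : Integrable u mIoo) (h0 : ∀ x, 0 ≤ u x) {ε : ℝ}
    (hε : 0 < ε) (t : ℝ) :
    ‖truncT ε (fun x => (u x : ℂ)) t‖ ≤
      |(cauchyW ((Ioo (-1 : ℝ) 1).indicator u) (t + ε * Complex.I)).im| +
        (cauchyW ((Ioo (-1 : ℝ) 1).indicator u) (t + ε * Complex.I)).re := by
  have h := abs_integral_truncKernel_add_im_le (integrable_indicator_mIoo hu)
    (indicator_nonneg fun x _ => h0 x) hε t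
  have e : ∫ x, u x * truncKernel ε (x - t) ∂mIoo =
      ∫ x, (Ioo (-1 : ℝ) 1).indicator u x * truncKernel ε (x - t) := by
    rw [integral_mIoo]
    congr 1
    ext x
    by_cases hx : x ∈ Ioo (-1 : ℝ) 1
    · rw [indicator_of_mem hx, indicator_of_mem hx]
    · rw [indicator_of_notMem hx, indicator_of_notMem hx, zero_mul]
  rw [truncT_ofReal, Complex.norm_real, Real.norm_eq_abs, e]
  have := abs_sub_abs_le_abs_sub (∫ x, (Ioo (-1 : ℝ) 1).indicator u x * truncKernel ε (x - t))
    (-(cauchyW ((Ioo (-1 : ℝ) 1).indicator u) (t + ε * Complex.I)).im)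
  rw [sub_neg_eq_add, abs_neg] at this
  linarith

theorem volume_truncT_ofReal_ge_le {u : ℝ → ℝ} (hu : Integrable u mIoo) (h0 : ∀ x, 0 ≤ u x)
    {l : ℝ} (hl : 0 < l) :
    volume {t : ℝ | ∃ ε : ℝ, 0 < ε ∧ 2 * l ≤ ‖truncT ε (fun x => (u x : ℂ)) t‖} ≤
      ENNReal.ofReal (200 * (∫ x, u x ∂mIoo) / l) := by
  rw [integral_mIoo]
  refine (measure_mono ?_).trans (volume_cauchyW_ge_le (integrable_indicator_mIoo hu)
    (indicator_nonneg fun x _ => h0 x) zero_le_one (fun x hx => indicator_of_notMem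
      (fun h : x ∈ Ioo (-1 : ℝ) 1 => hx.not_gt (abs_lt.2 h)) u) hl)
  rintro t ⟨ε, hε, h⟩
  refine ⟨ε, hε, ?_⟩
  have := norm_truncT_ofReal_le hu h0 hε t
  have h1 := Complex.abs_im_le_norm (cauchyW ((Ioo (-1 : ℝ) 1).indicator u) (t + ε * Complex.I))
  have h2 := Complex.re_le_norm (cauchyW ((Ioo (-1 : ℝ) 1).indicator u) (t + ε * Complex.I))
  linarith

/-- The decomposition of a complex function into four nonnegative parts. -/
theorem ofReal_parts (z : ℂ) : ((max z.re 0 : ℝ) : ℂ) + ((-1) * ((max (-z.re) 0 : ℝ) : ℂ) +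
    (Complex.I * ((max z.im 0 : ℝ) : ℂ) + (-Complex.I) * ((max (-z.im) 0 : ℝ) : ℂ))) = z := by
  have h : ∀ a : ℝ, max a 0 - max (-a) 0 = a := fun a => by
    rcases le_total a 0 with h | h
    · rw [max_eq_right h, max_eq_left (by linarith)]; ring
    · rw [max_eq_left h, max_eq_right (by linarith)]; ring
  apply Complex.ext
  · simp [← sub_eq_add_neg, h]
  · simp [← sub_eq_add_neg, h]

theorem truncT_parts {u : ℝ → ℂ} (hu : Integrable u mIoo) {ε : ℝ} (hε : 0 < ε) (t : ℝ) :
    truncT ε u t = truncT ε (fun x => ((max (u x).re 0 : ℝ) : ℂ)) t +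
      ((-1) * truncT ε (fun x => ((max (-(u x).re) 0 : ℝ) : ℂ)) t +
      (Complex.I * truncT ε (fun x => ((max (u x).im 0 : ℝ) : ℂ)) t +
      (-Complex.I) * truncT ε (fun x => ((max (-(u x).im) 0 : ℝ) : ℂ)) t)) := by
  have i1 : Integrable (fun x => ((max (u x).re 0 : ℝ) : ℂ)) mIoo := hu.re.pos_part.ofReal
  have i2 : Integrable (fun x => ((max (-(u x).re) 0 : ℝ) : ℂ)) mIoo := hu.re.neg_part.ofReal
  have i3 : Integrable (fun x => ((max (u x).im 0 : ℝ) : ℂ)) mIoo := hu.im.pos_part.ofReal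
  have i4 : Integrable (fun x => ((max (-(u x).im) 0 : ℝ) : ℂ)) mIoo := hu.im.neg_part.ofReal
  have i34 : Integrable (fun x => Complex.I * ((max (u x).im 0 : ℝ) : ℂ) +
      (-Complex.I) * ((max (-(u x).im) 0 : ℝ) : ℂ)) mIoo := (i3.const_mul _).add (i4.const_mul _)
  have i234 : Integrable (fun x => (-1) * ((max (-(u x).re) 0 : ℝ) : ℂ) +
      (Complex.I * ((max (u x).im 0 : ℝ) : ℂ) +
      (-Complex.I) * ((max (-(u x).im) 0 : ℝ) : ℂ))) mIoo := (i2.const_mul _).add i34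
  rw [← truncT_const_mul, ← truncT_const_mul, ← truncT_const_mul,
    ← truncT_add (i3.const_mul _) (i4.const_mul _) hε,
    ← truncT_add (i2.const_mul _) i34 hε, ← truncT_add i1 i234 hε]
  simp_rw [ofReal_parts]

theorem norm_truncT_le_parts {u : ℝ → ℂ} (hu : Integrable u mIoo) {ε : ℝ} (hε : 0 < ε) (t : ℝ) :
    ‖truncT ε u t‖ ≤ ‖truncT ε (fun x => ((max (u x).re 0 : ℝ) : ℂ)) t‖ +
      (‖truncT ε (fun x => ((max (-(u x).re) 0 : ℝ) : ℂ)) t‖ +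
      (‖truncT ε (fun x => ((max (u x).im 0 : ℝ) : ℂ)) t‖ +
      ‖truncT ε (fun x => ((max (-(u x).im) 0 : ℝ) : ℂ)) t‖)) := by
  rw [truncT_parts hu hε t]
  refine (norm_add_le _ _).trans (add_le_add_right ((norm_add_le _ _).trans (add_le_add ?_
    ((norm_add_le _ _).trans (add_le_add ?_ ?_)))) _) <;> simp

theorem part_le_norm (z : ℂ) : max z.re 0 ≤ ‖z‖ ∧ max (-z.re) 0 ≤ ‖z‖ ∧ max z.im 0 ≤ ‖z‖ ∧
    max (-z.im) 0 ≤ ‖z‖ := by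
  have h1 := abs_le.1 (Complex.abs_re_le_norm z)
  have h2 := abs_le.1 (Complex.abs_im_le_norm z)
  refine ⟨max_le ?_ (norm_nonneg z), max_le ?_ (norm_nonneg z), max_le ?_ (norm_nonneg z),
    max_le ?_ (norm_nonneg z)⟩ <;> linarith

/-- Weak type `(1,1)` estimate for the maximal truncated Hilbert transform. -/
theorem volume_truncT_ge_le {u : ℝ → ℂ} (hu : Integrable u mIoo) {l : ℝ} (hl : 0 < l) :
    volume {t : ℝ | ∃ ε : ℝ, 0 < ε ∧ l ≤ ‖truncT ε u t‖} ≤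
      ENNReal.ofReal (6400 * (∫ x, ‖u x‖ ∂mIoo) / l) := by
  have key : ∀ v : ℝ → ℝ, Integrable v mIoo → (∀ x, 0 ≤ v x) → (∀ x, v x ≤ ‖u x‖) →
      volume {t : ℝ | ∃ ε : ℝ, 0 < ε ∧ 2 * (l / 8) ≤ ‖truncT ε (fun x => (v x : ℂ)) t‖} ≤
      ENNReal.ofReal (1600 * (∫ x, ‖u x‖ ∂mIoo) / l) := by
    intro v hv h0 hle
    refine (volume_truncT_ofReal_ge_le hv h0 (by positivity)).trans (ENNReal.ofReal_le_ofReal ?_)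
    have := integral_mono hv hu.norm hle
    rw [div_div_eq_mul_div]
    refine div_le_div_of_nonneg_right ?_ hl.le
    linarith
  have hc : (6400 : ℝ) * (∫ x, ‖u x‖ ∂mIoo) / l = 1600 * (∫ x, ‖u x‖ ∂mIoo) / l +
    (1600 * (∫ x, ‖u x‖ ∂mIoo) / l + (1600 * (∫ x, ‖u x‖ ∂mIoo) / l +
      1600 * (∫ x, ‖u x‖ ∂mIoo) / l)) := by ring
  have hM : 0 ≤ ∫ x, ‖u x‖ ∂mIoo := integral_nonneg fun x => norm_nonneg _
  rw [hc, ENNReal.ofReal_add (by positivity) (by positivity),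
    ENNReal.ofReal_add (by positivity) (by positivity),
    ENNReal.ofReal_add (by positivity) (by positivity)]
  refine le_trans (measure_mono ?_) ((measure_union_le _ _).trans (add_le_add
    (key _ hu.re.pos_part (fun x => le_max_right _ _) fun x => (part_le_norm (u x)).1)
    ((measure_union_le _ _).trans (add_le_add
    (key _ hu.re.neg_part (fun x => le_max_right _ _) fun x => (part_le_norm (u x)).2.1)
    ((measure_union_le _ _).trans (add_le_add
    (key _ hu.im.pos_part (fun x => le_max_right _ _) fun x => (part_le_norm (u x)).2.2.1)
    (key _ hu.im.neg_part (fun x => le_max_right _ _) fun x => (part_le_norm (u x)).2.2.2)))))))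
  rintro t ⟨ε, hε, h⟩
  by_contra hcon
  simp only [mem_union, mem_ofPred_eq, not_or, not_exists, not_and, not_le] at hcon
  have h1 := hcon.1 ε hε
  have h2 := hcon.2.1 ε hε
  have h3 := hcon.2.2.1 ε hε
  have h4 := hcon.2.2.2 ε hε
  have := norm_truncT_le_parts hu hε t
  simp only [RCLike.re_eq_complex_re, RCLike.im_eq_complex_im] at h1 h2 h3 h4
  linarith

instance isFiniteMeasure_mIoo : IsFiniteMeasure mIoo :=
  ⟨by simp [mIoo]⟩

/-- The principal value integral defining `FHT`, expressed through `truncT`. -/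
theorem integral_add_integral_eq_truncT {u : ℝ → ℂ} (hu : Integrable u mIoo) {t : ℝ}
    (ht : t ∈ Ioo (-1 : ℝ) 1) {ε : ℝ} (hε : 0 < ε) :
    (∫ x in Ioo (-1 : ℝ) (t - ε), u x / (↑x - ↑t)) + ∫ x in Ioo (t + ε) (1 : ℝ), u x / (↑x - ↑t) =
      truncT ε u t := by
  have hk : ∀ x, ε < |x - t| → u x * (truncKernel ε (x - t) : ℂ) = u x / (↑x - ↑t) := by
    intro x hx
    rw [truncKernel, if_pos hx]
    push_cast
    rw [div_eq_mul_inv]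
  have h1 : ∀ x ∈ Ioo (-1 : ℝ) (t - ε), ε < |x - t| := fun x hx => by
    rw [abs_sub_comm]; exact (lt_abs.2 (Or.inl (by linarith [hx.2])))
  have h2 : ∀ x ∈ Ioo (t + ε) 1, ε < |x - t| := fun x hx => lt_abs.2 (Or.inl (by linarith [hx.1]))
  have hint := integrable_mul_truncKernel hu hε t
  have s1 : Ioo (-1 : ℝ) (t - ε) ⊆ Ioo (-1) 1 := Ioo_subset_Ioo_right (by linarith [ht.2])
  have s2 : Ioo (t + ε) (1 : ℝ) ⊆ Ioo (-1) 1 := Ioo_subset_Ioo_left (by linarith [ht.1])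
  have hint' : IntegrableOn (fun x => u x * (truncKernel ε (x - t) : ℂ)) (Ioo (-1 : ℝ) 1) := hint
  rw [← setIntegral_congr_fun measurableSet_Ioo fun x hx => hk x (h1 x hx),
    ← setIntegral_congr_fun measurableSet_Ioo fun x hx => hk x (h2 x hx),
    ← setIntegral_union (Set.disjoint_left.2 fun x hx hx' => by linarith [hx.2, hx'.1])
      measurableSet_Ioo (hint'.mono_set s1) (hint'.mono_set s2)]
  unfold truncT mIoo
  symm
  refine setIntegral_eq_of_subset_of_forall_sdiff_eq_zero measurableSet_Ioo
    (union_subset s1 s2) fun x hx => ?_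
  have : ¬ ε < |x - t| := by
    intro h
    rcases lt_abs.1 h with h | h
    · exact hx.2 (Or.inr ⟨by linarith, hx.1.2⟩)
    · exact hx.2 (Or.inl ⟨hx.1.1, by linarith⟩)
  simp [truncKernel, this]

theorem integral_eq_zero_of_odd {D : ℝ → ℂ} (h : ∀ s, D (-s) = -D s) : ∫ s, D s = 0 := by
  have h2 : ∫ s, D (-s) = ∫ s, D s := integral_neg_eq_self D volume
  simp_rw [h, integral_neg] at h2
  exact self_eq_neg.1 h2.symm

theorem truncT_one_eq {t δ ε ε' : ℝ} (h1 : -1 < t - δ) (h2 : t + δ < 1) (hε : 0 < ε) (hεδ : ε ≤ δ)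
    (hε' : 0 < ε') (hεδ' : ε' ≤ δ) : truncT ε (fun _ => 1) t = truncT ε' (fun _ => 1) t := by
  have hi : Integrable (fun _ : ℝ => (1 : ℂ)) mIoo := integrable_const _
  rw [← sub_eq_zero]
  unfold truncT
  rw [← integral_sub (integrable_mul_truncKernel hi hε t) (integrable_mul_truncKernel hi hε' t),
    mIoo, setIntegral_eq_integral_of_forall_compl_eq_zero]
  · rw [integral_sub_right_eq_self
      (fun s => (1 : ℂ) * (truncKernel ε s : ℂ) - (1 : ℂ) * (truncKernel ε' s : ℂ)) t]
    refine integral_eq_zero_of_odd fun s => ?_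
    rw [truncKernel_neg, truncKernel_neg]
    push_cast
    ring
  · intro x hx
    have : δ < |x - t| := by
      by_contra hcon
      rw [not_lt, abs_le] at hcon
      exact hx ⟨by linarith, by linarith⟩
    simp [truncKernel, hεδ.trans_lt this, hεδ'.trans_lt this]

theorem tendsto_truncKernel (s : ℝ) :
    Tendsto (fun ε => truncKernel ε s) (𝓝[>] 0) (𝓝 s⁻¹) := by
  rcases eq_or_ne s 0 with rfl | hs
  · refine tendsto_const_nhds.congr fun ε => ?_
    simp [truncKernel]
  · refine tendsto_const_nhds.congr' ?_
    filter_upwards [Ioo_mem_nhdsGT (abs_pos.2 hs)] with ε hε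
    rw [truncKernel, if_pos hε.2]

theorem exists_tendsto_truncT_of_lipschitz {φ : ℝ → ℂ} {K : NNReal} (hφ : LipschitzWith K φ)
    {t : ℝ} (ht : t ∈ Ioo (-1 : ℝ) 1) :
    ∃ L : ℂ, Tendsto (fun ε => truncT ε φ t) (𝓝[>] 0) (𝓝 L) := by
  obtain ⟨δ, hδ, hδ1, hδ2⟩ : ∃ δ : ℝ, 0 < δ ∧ -1 < t - δ ∧ t + δ < 1 := by
    refine ⟨min (1 - t) (1 + t) / 2, ?_, ?_, ?_⟩
    · have : 0 < min (1 - t) (1 + t) := lt_min (by linarith [ht.2]) (by linarith [ht.1])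
      linarith
    · have := min_le_right (1 - t) (1 + t)
      linarith [ht.1]
    · have := min_le_left (1 - t) (1 + t)
      linarith [ht.2]
  have hi1 : Integrable (fun _ : ℝ => φ t * (1 : ℂ)) mIoo := integrable_const _
  have hi2 : Integrable (fun x : ℝ => φ x - φ t) mIoo := by
    have hc : Continuous fun x : ℝ => φ x - φ t := hφ.continuous.sub continuous_const
    exact (hc.integrableOn_Icc (a := -1) (b := 1)).mono_set Ioo_subset_Icc_self
  refine ⟨(∫ x, (φ x - φ t) * (((x - t)⁻¹ : ℝ) : ℂ) ∂mIoo) + φ t * truncT δ (fun _ => 1) t, ?_⟩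
  have key : ∀ᶠ ε : ℝ in 𝓝[>] 0, (∫ x, (φ x - φ t) * (truncKernel ε (x - t) : ℂ) ∂mIoo) +
      φ t * truncT δ (fun _ => 1) t = truncT ε φ t := by
    filter_upwards [Ioo_mem_nhdsGT hδ] with ε hε
    rw [truncT_one_eq hδ1 hδ2 hδ le_rfl hε.1 hε.2.le, ← truncT_const_mul]
    have := truncT_add hi2 hi1 hε.1 t
    simp only [mul_one, sub_add_cancel] at this
    simp only [mul_one]
    exact this.symm
  refine Tendsto.congr' key (Tendsto.add_const _ ?_)
  refine tendsto_integral_filter_of_dominated_convergence (fun _ => (K : ℝ)) ?_ ?_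
    (integrable_const _) ?_
  · filter_upwards [self_mem_nhdsWithin] with ε hε
    exact (integrable_mul_truncKernel hi2 hε t).aestronglyMeasurable
  · refine Eventually.of_forall fun ε => Eventually.of_forall fun x => ?_
    rw [norm_mul, Complex.norm_real, truncKernel, Real.norm_eq_abs]
    have h := hφ.norm_sub_le x t
    rw [Real.norm_eq_abs] at h
    split_ifs with hx
    · rw [abs_inv]
      rcases eq_or_ne (x - t) 0 with h0 | h0
      · simp [h0]
      · exact mul_inv_le_of_le_mul₀ (abs_nonneg _) K.2 h
    · simp
  · refine Eventually.of_forall fun x => Tendsto.const_mul _ ?_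
    exact (Complex.continuous_ofReal.tendsto _).comp (tendsto_truncKernel (x - t))

theorem exists_lipschitz_integral_sub_le {u : ℝ → ℂ} (hu : Integrable u mIoo) {η : ℝ}
    (hη : 0 < η) : ∃ (φ : ℝ → ℂ) (K : NNReal), LipschitzWith K φ ∧ Integrable φ mIoo ∧
      ∫ x, ‖u x - φ x‖ ∂mIoo ≤ η := by
  obtain ⟨φ, hc, hs, h⟩ := (memLp_one_iff_integrable.2 hu).exist_eLpNorm_sub_le ENNReal.one_ne_top
    le_rfl hη
  obtain ⟨K, hK⟩ := hs.lipschitzWith_of_hasCompactSupport hc (by simp)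
  have hφ : Integrable φ mIoo :=
    (hK.continuous.integrableOn_Icc (a := -1) (b := 1)).mono_set Ioo_subset_Icc_self
  refine ⟨φ, K, hK, hφ, ?_⟩
  rw [eLpNorm_one_eq_lintegral_enorm] at h
  change ∫ x, ‖(u - φ) x‖ ∂mIoo ≤ η
  rw [← ENNReal.ofReal_le_ofReal_iff hη.le, ofReal_integral_norm_eq_lintegral_enorm (hu.sub hφ)]
  exact h

/-- Almost everywhere existence of the principal value. -/
theorem ae_exists_tendsto_truncT {u : ℝ → ℂ} (hu : Integrable u mIoo) :
    ∀ᵐ t ∂mIoo, ∃ L : ℂ, Tendsto (fun ε => truncT ε u t) (𝓝[>] 0) (𝓝 L) := by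
  have key : ∀ n : ℕ, ∀ᵐ t ∂mIoo, ∃ δ > (0 : ℝ), ∀ ε ∈ Ioo 0 δ, ∀ ε' ∈ Ioo 0 δ,
      dist (truncT ε u t) (truncT ε' u t) < 3 * (1 / ((n : ℝ) + 1)) := by
    intro n
    set l : ℝ := 1 / ((n : ℝ) + 1) with hl_def
    have hl : 0 < l := by positivity
    rw [ae_iff]
    refine le_antisymm (ENNReal.le_of_forall_pos_le_add fun η hη _ => ?_) bot_le
    rw [zero_add]
    obtain ⟨φ, K, hK, hφ, h⟩ := exists_lipschitz_integral_sub_le hu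
      (show (0 : ℝ) < l * η / 6400 by positivity)
    have hw := volume_truncT_ge_le (hu.sub hφ) hl
    have hle : ENNReal.ofReal (6400 * (∫ x, ‖(u - φ) x‖ ∂mIoo) / l) ≤ η := by
      rw [← ENNReal.ofReal_coe_nnreal]
      refine ENNReal.ofReal_le_ofReal ?_
      rw [div_le_iff₀ hl]
      simp only [Pi.sub_apply]
      linarith
    refine le_trans ?_ (hw.trans hle)
    have hae : ∀ᵐ t ∂mIoo, t ∈ Ioo (-1 : ℝ) 1 := ae_restrict_mem measurableSet_Ioo
    refine le_trans (measure_mono_ae ?_) (Measure.restrict_apply_le (Ioo (-1 : ℝ) 1) _)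
    filter_upwards [hae] with t ht hbad
    by_contra hcon
    change ¬ ∃ ε : ℝ, 0 < ε ∧ l ≤ ‖truncT ε (u - φ) t‖ at hcon
    push Not at hcon
    refine hbad ?_
    obtain ⟨L, hL⟩ := exists_tendsto_truncT_of_lipschitz hK ht
    have hc := Metric.cauchy_iff.1 hL.cauchy_map
    obtain ⟨S, hS, hS'⟩ := hc.2 l hl
    obtain ⟨δ, hδ, hδS⟩ := mem_nhdsGT_iff_exists_Ioo_subset.1 (mem_map.1 hS)
    refine ⟨δ, hδ, fun ε hε ε' hε' => ?_⟩
    have h1 := hS' _ (hδS hε) _ (hδS hε')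
    have h2 := hcon ε hε.1
    have h3 := hcon ε' hε'.1
    have e : ∀ r : ℝ, 0 < r → truncT r u t = truncT r (u - φ) t + truncT r φ t := fun r hr => by
      rw [← truncT_add (hu.sub hφ) hφ hr]
      simp
    rw [dist_eq_norm] at h1 ⊢
    rw [e ε hε.1, e ε' hε'.1, show ∀ a b c d : ℂ, a + b - (c + d) = a + -c + (b - d) by
      intros; ring]
    refine (norm_add_le _ _).trans_lt ?_
    have := norm_add_le (truncT ε (u - φ) t) (-truncT ε' (u - φ) t)
    rw [norm_neg] at this
    linarith
  filter_upwards [ae_all_iff.2 key] with t ht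
  rw [← cauchy_map_iff_exists_tendsto, Metric.cauchy_iff]
  refine ⟨map_neBot, fun η hη => ?_⟩
  obtain ⟨n, hn⟩ := exists_nat_one_div_lt (show 0 < η / 3 by positivity)
  obtain ⟨δ, hδ, h⟩ := ht n
  refine ⟨_, image_mem_map (Ioo_mem_nhdsGT hδ), ?_⟩
  rintro _ ⟨ε, hε, rfl⟩ _ ⟨ε', hε', rfl⟩
  have := h ε hε ε' hε'
  linarith

theorem tendsto_truncT_FHT {u : ℝ → ℂ} (hu : Integrable u mIoo) :
    ∀ᵐ t ∂mIoo, Tendsto (fun ε => (Real.pi : ℂ)⁻¹ * truncT ε u t) (𝓝[>] 0) (𝓝 (FHT u t)) := by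
  filter_upwards [ae_exists_tendsto_truncT hu, ae_restrict_mem measurableSet_Ioo] with t ht ht'
  obtain ⟨L, hL⟩ := ht
  have h1 := hL.const_mul (Real.pi : ℂ)⁻¹
  have h2 : (fun ε => (Real.pi : ℂ)⁻¹ * truncT ε u t) =ᶠ[𝓝[>] 0] fun ε =>
      (Real.pi : ℂ)⁻¹ * ((∫ x in Set.Ioo (-1 : ℝ) (t - ε), u x / (↑x - ↑t)) +
      ∫ x in Set.Ioo (t + ε) (1 : ℝ), u x / (↑x - ↑t)) := by
    filter_upwards [self_mem_nhdsWithin] with ε hε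
    rw [integral_add_integral_eq_truncT hu ht' hε]
  have h3 : FHT u t = (Real.pi : ℂ)⁻¹ * L := (h1.congr' h2).limUnder_eq
  rw [h3]
  exact h1

theorem lintegral_le_of_ae_tendsto {α : Type*} {m : MeasurableSpace α} {μ : Measure α}
    {F : ℕ → α → ℝ≥0∞} {G : α → ℝ≥0∞} {M : ℝ≥0∞} (hF : ∀ n, AEMeasurable (F n) μ)
    (hM : ∀ n, ∫⁻ x, F n x ∂μ ≤ M)
    (hlim : ∀ᵐ x ∂μ, Tendsto (fun n => F n x) atTop (𝓝 (G x))) : ∫⁻ x, G x ∂μ ≤ M := by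
  calc ∫⁻ x, G x ∂μ = ∫⁻ x, liminf (fun n => F n x) atTop ∂μ :=
        lintegral_congr_ae (hlim.mono fun x hx => hx.liminf_eq.symm)
    _ ≤ liminf (fun n => ∫⁻ x, F n x ∂μ) atTop := lintegral_liminf_le' hF
    _ ≤ M := liminf_le_of_frequently_le' (Frequently.of_forall hM)

theorem tendsto_one_div_nhdsGT : Tendsto (fun n : ℕ => 1 / ((n : ℝ) + 1)) atTop (𝓝[>] 0) :=
  tendsto_nhdsWithin_iff.2 ⟨tendsto_one_div_add_atTop_nhds_zero_nat,
    Eventually.of_forall fun n => mem_Ioi.2 (by positivity)⟩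

theorem aestronglyMeasurable_mul_truncKernel {u v : ℝ → ℂ} (hu : AEStronglyMeasurable u mIoo)
    (hv : AEStronglyMeasurable v mIoo) (ε : ℝ) :
    AEStronglyMeasurable (fun p : ℝ × ℝ => v p.1 * (u p.2 * (truncKernel ε (p.2 - p.1) : ℂ)))
      (mIoo.prod mIoo) :=
  hv.comp_fst.mul (hu.comp_snd.mul (Complex.measurable_ofReal.comp ((measurable_truncKernel ε).comp
    (measurable_snd.sub measurable_fst))).aestronglyMeasurable)

theorem aestronglyMeasurable_truncT {u : ℝ → ℂ} (hu : AEStronglyMeasurable u mIoo) (ε : ℝ) :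
    AEStronglyMeasurable (truncT ε u) mIoo := by
  have h := (aestronglyMeasurable_mul_truncKernel hu
    (aestronglyMeasurable_const (b := (1 : ℂ))) ε).integral_prod_right'
  simp only [one_mul] at h
  exact h

theorem aestronglyMeasurable_FHT {u : ℝ → ℂ} (hu : Integrable u mIoo) :
    AEStronglyMeasurable (FHT u) mIoo := by
  refine aestronglyMeasurable_of_tendsto_ae atTop
    (f := fun (n : ℕ) t => (Real.pi : ℂ)⁻¹ * truncT (1 / ((n : ℝ) + 1)) u t)
    (fun n => (aestronglyMeasurable_truncT hu.aestronglyMeasurable _).const_mul _) ?_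
  filter_upwards [tendsto_truncT_FHT hu] with t ht
  exact ht.comp tendsto_one_div_nhdsGT

theorem FHT_congr_ae {u v : ℝ → ℂ} (hu : Integrable u mIoo) (h : u =ᵐ[mIoo] v) :
    FHT u =ᵐ[mIoo] FHT v := by
  filter_upwards [tendsto_truncT_FHT hu, tendsto_truncT_FHT (hu.congr h)] with t h1 h2
  simp_rw [truncT_congr h] at h1
  exact tendsto_nhds_unique h1 h2

theorem FHT_add_ae {u v : ℝ → ℂ} (hu : Integrable u mIoo) (hv : Integrable v mIoo) :
    FHT (fun x => u x + v x) =ᵐ[mIoo] fun t => FHT u t + FHT v t := by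
  filter_upwards [tendsto_truncT_FHT hu, tendsto_truncT_FHT hv,
    tendsto_truncT_FHT (hu.add hv)] with t h1 h2 h3
  refine tendsto_nhds_unique h3 ((h1.add h2).congr' ?_)
  filter_upwards [self_mem_nhdsWithin] with ε hε
  rw [← mul_add, ← truncT_add hu hv hε]
  rfl

theorem FHT_const_mul_ae {u : ℝ → ℂ} (hu : Integrable u mIoo) (c : ℂ) :
    FHT (fun x => c * u x) =ᵐ[mIoo] fun t => c * FHT u t := by
  filter_upwards [tendsto_truncT_FHT hu, tendsto_truncT_FHT (hu.const_mul c)] with t h1 h2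
  refine tendsto_nhds_unique h2 ((h1.const_mul c).congr fun ε => ?_)
  rw [truncT_const_mul]
  ring

theorem FHT_sub_ae {u v : ℝ → ℂ} (hu : Integrable u mIoo) (hv : Integrable v mIoo) :
    FHT (fun x => u x - v x) =ᵐ[mIoo] fun t => FHT u t - FHT v t := by
  have h := FHT_add_ae hu (hv.const_mul (-1))
  filter_upwards [h, FHT_const_mul_ae hv (-1)] with t h1 h2
  rw [h2] at h1
  simp only [neg_mul, one_mul, ← sub_eq_add_neg] at h1
  exact h1

/-- Weak type `(1,1)` estimate for the finite Hilbert transform. -/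
theorem mIoo_FHT_ge_le {u : ℝ → ℂ} (hu : Integrable u mIoo) {l : ℝ} (hl : 0 < l) :
    mIoo {t | l ≤ ‖FHT u t‖} ≤ ENNReal.ofReal (12800 * (∫ x, ‖u x‖ ∂mIoo) / l) := by
  have h := volume_truncT_ge_le hu (half_pos hl)
  rw [show 6400 * (∫ x, ‖u x‖ ∂mIoo) / (l / 2) = 12800 * (∫ x, ‖u x‖ ∂mIoo) / l by
    field_simp; ring] at h
  refine le_trans ((measure_mono_ae ?_).trans (Measure.restrict_apply_le (Ioo (-1 : ℝ) 1) _)) h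
  filter_upwards [tendsto_truncT_FHT hu] with t ht h
  change l ≤ ‖FHT u t‖ at h
  have h1 := (ht.norm.eventually (lt_mem_nhds (show l / 2 < ‖FHT u t‖ by linarith))).and
    self_mem_nhdsWithin
  obtain ⟨ε, h2, hε⟩ := h1.exists
  refine ⟨ε, hε, ?_⟩
  rw [norm_mul, norm_inv, Complex.norm_real, Real.norm_eq_abs, abs_of_pos Real.pi_pos] at h2
  have h3 : Real.pi⁻¹ ≤ 1 := inv_le_one_of_one_le₀ (by linarith [Real.two_le_pi])
  nlinarith [norm_nonneg (truncT ε u t)]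

theorem tendstoInMeasure_FHT {u : ℕ → ℝ → ℂ} {v : ℝ → ℂ} (hu : ∀ n, Integrable (u n) mIoo)
    (hv : Integrable v mIoo)
    (h : Tendsto (fun n => ∫ x, ‖u n x - v x‖ ∂mIoo) atTop (𝓝 0)) :
    TendstoInMeasure mIoo (fun n => FHT (u n)) atTop (FHT v) := by
  rw [tendstoInMeasure_iff_norm]
  intro ε hε
  have h1 : Tendsto (fun n => ENNReal.ofReal (12800 * (∫ x, ‖u n x - v x‖ ∂mIoo) / ε)) atTop
      (𝓝 0) := by
    have := ENNReal.tendsto_ofReal ((h.const_mul 12800).div_const ε)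
    simpa using this
  refine tendsto_of_tendsto_of_tendsto_of_le_of_le tendsto_const_nhds h1 (fun n => bot_le)
    fun n => ?_
  refine le_trans (measure_mono_ae ?_) (mIoo_FHT_ge_le ((hu n).sub hv) hε)
  filter_upwards [FHT_sub_ae (hu n) hv] with t ht h
  change ε ≤ ‖FHT (fun x => u n x - v x) t‖
  rw [ht]
  exact h

theorem exists_subseq_tendsto_FHT {u : ℕ → ℝ → ℂ} {v : ℝ → ℂ} (hu : ∀ n, Integrable (u n) mIoo)
    (hv : Integrable v mIoo)
    (h : Tendsto (fun n => ∫ x, ‖u n x - v x‖ ∂mIoo) atTop (𝓝 0)) :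
    ∃ ns : ℕ → ℕ, StrictMono ns ∧
      ∀ᵐ t ∂mIoo, Tendsto (fun i => FHT (u (ns i)) t) atTop (𝓝 (FHT v t)) :=
  (tendstoInMeasure_FHT hu hv h).exists_seq_tendsto_ae

theorem lintegral_truncT_ofReal_sq_le {u : ℝ → ℝ} (hu : Integrable u mIoo) (h0 : ∀ x, 0 ≤ u x)
    {B : ℝ} (hB : ∀ x, u x ≤ B) {ε : ℝ} (hε : 0 < ε) :
    ∫⁻ t, ENNReal.ofReal (‖truncT ε (fun x => (u x : ℂ)) t‖ ^ 2) ≤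
      ENNReal.ofReal (8 * Real.pi ^ 2 * B ^ 2) := by
  set v := (Ioo (-1 : ℝ) 1).indicator u with hv_def
  have hv : Integrable v := integrable_indicator_mIoo hu
  have hv0 : ∀ x, 0 ≤ v x := indicator_nonneg fun x _ => h0 x
  have hB0 : 0 ≤ B := (h0 0).trans (hB 0)
  have hvB : ∀ x, v x ≤ B := indicator_le' (fun x _ => hB x) fun x _ => hB0
  set W : ℝ → ℂ := fun t => cauchyW v (t + ε * Complex.I) with hW
  have hvint : ∫ x, v x ≤ 2 * B := by
    rw [hv_def, ← integral_mIoo]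
    calc ∫ x, u x ∂mIoo ≤ ∫ x, B ∂mIoo := integral_mono hu (integrable_const _) hB
      _ = 2 * B := by simp [mIoo, measureReal_def]; norm_num
  have hP0 : ∀ t, 0 ≤ (W t).re := fun t => re_cauchyW_nonneg hv hv0 (by simp [hε])
  have hPB : ∀ t, (W t).re ≤ B * Real.pi := by
    intro t
    rw [hW]
    simp only
    rw [re_cauchyW_eq hv t hε, ← integral_poissonKernel t hε, ← integral_const_mul]
    have hi := (integrable_poissonKernel t hε).const_mul B
    refine integral_mono_of_nonneg (Eventually.of_forall fun x => ?_) hi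
      (Eventually.of_forall fun x => ?_)
    · have := hv0 x
      positivity
    · simp only
      rw [show (x - t) ^ 2 = (t - x) ^ 2 by ring]
      exact mul_le_mul_of_nonneg_right (hvB x) (by positivity)
  have hPi : Integrable fun t => (W t).re := integrable_re_cauchyW hv hε
  have hWc : Continuous W := continuous_cauchyW_line hv hε
  have hP2 : Integrable fun t => (W t).re ^ 2 := by
    refine (hPi.const_mul (B * Real.pi)).mono' ?_ (Eventually.of_forall fun t => ?_)
    · exact ((Complex.continuous_re.comp hWc).pow 2).aestronglyMeasurable
    · rw [Real.norm_eq_abs, abs_of_nonneg (sq_nonneg _), sq]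
      exact mul_le_mul_of_nonneg_right (hPB t) (hP0 t)
  have hP2int : ∫ t, (W t).re ^ 2 ≤ 2 * Real.pi ^ 2 * B ^ 2 := by
    calc ∫ t, (W t).re ^ 2 ≤ ∫ t, B * Real.pi * (W t).re := by
          refine integral_mono hP2 (hPi.const_mul (B * Real.pi)) fun t => ?_
          simp only
          rw [sq]
          exact mul_le_mul_of_nonneg_right (hPB t) (hP0 t)
      _ = B * Real.pi * ((∫ x, v x) * Real.pi) := by
          rw [integral_const_mul, integral_re_cauchyW hv hε]
      _ ≤ B * Real.pi * ((2 * B) * Real.pi) := by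
          have := Real.pi_pos
          gcongr
      _ = _ := by ring
  obtain ⟨hi, hz⟩ := integral_horizontal_line_eq_zero (H := fun z => cauchyW v z ^ 2) (s := ε)
    (C := (∫ x, |v x|) ^ 2 * ((1 / ε) ^ 2 + (1 + 1 / ε) ^ 2)) hε.le
    (fun z hz => ((differentiableAt_cauchyW hv (hε.trans_le hz)).pow 2).differentiableWithinAt)
    (fun z hz => by
      rw [norm_pow]
      exact norm_cauchyW_sq_le hv hε zero_le_one (fun x hx => indicator_of_notMem
        (fun h : x ∈ Ioo (-1 : ℝ) 1 => hx.not_gt (abs_lt.2 h)) u) hz)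
  have hre : ∀ t, (W t ^ 2).re = (W t).re ^ 2 - (W t).im ^ 2 := fun t => by
    rw [sq, Complex.mul_re]; ring
  have hi' : Integrable fun t => (W t ^ 2).re := hi.re
  have hz' : ∫ t, (W t ^ 2).re = 0 := by
    have := integral_re hi
    simp only [RCLike.re_eq_complex_re] at this
    rw [show (fun t => (W t ^ 2).re) = fun a : ℝ => (cauchyW v (a + ε * Complex.I) ^ 2).re from rfl,
      this, hz, Complex.zero_re]
  have hQ2 : Integrable fun t => (W t).im ^ 2 := by
    refine (hP2.sub hi').congr (Eventually.of_forall fun t => ?_)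
    simp only [Pi.sub_apply, hre]
    ring
  have hQ2int : ∫ t, (W t).im ^ 2 = ∫ t, (W t).re ^ 2 := by
    simp_rw [hre] at hz'
    rw [integral_sub hP2 hQ2] at hz'
    linarith
  have hle : ∀ t, ‖truncT ε (fun x => (u x : ℂ)) t‖ ^ 2 ≤ 2 * (W t).im ^ 2 + 2 * (W t).re ^ 2 := by
    intro t
    have h1 := norm_truncT_ofReal_le hu h0 hε t
    have h2 : ‖truncT ε (fun x => (u x : ℂ)) t‖ ^ 2 ≤ (|(W t).im| + (W t).re) ^ 2 := by
      gcongr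
    rw [← sq_abs (W t).im]
    nlinarith [sq_nonneg (|(W t).im| - (W t).re)]
  have hsum : Integrable fun t => 2 * (W t).im ^ 2 + 2 * (W t).re ^ 2 :=
    (hQ2.const_mul 2).add (hP2.const_mul 2)
  calc ∫⁻ t, ENNReal.ofReal (‖truncT ε (fun x => (u x : ℂ)) t‖ ^ 2)
      ≤ ∫⁻ t, ENNReal.ofReal (2 * (W t).im ^ 2 + 2 * (W t).re ^ 2) :=
        lintegral_mono fun t => ENNReal.ofReal_le_ofReal (hle t)
    _ = ENNReal.ofReal (∫ t, 2 * (W t).im ^ 2 + 2 * (W t).re ^ 2) := by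
        rw [ofReal_integral_eq_lintegral_ofReal hsum
          (Eventually.of_forall fun t => by positivity)]
    _ ≤ _ := by
        refine ENNReal.ofReal_le_ofReal ?_
        rw [integral_add (hQ2.const_mul 2) (hP2.const_mul 2), integral_const_mul,
          integral_const_mul, hQ2int]
        linarith

/-- `L²` bound for truncated Hilbert transforms of bounded functions. -/
theorem lintegral_truncT_sq_le {u : ℝ → ℂ} (hu : AEStronglyMeasurable u mIoo) {B : ℝ}
    (hB : ∀ x, ‖u x‖ ≤ B) {ε : ℝ} (hε : 0 < ε) :
    ∫⁻ t, ENNReal.ofReal (‖truncT ε u t‖ ^ 2) ∂mIoo ≤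
      ENNReal.ofReal (128 * Real.pi ^ 2 * B ^ 2) := by
  have hui : Integrable u mIoo :=
    Integrable.of_bound hu B (Eventually.of_forall hB)
  have key : ∀ v : ℝ → ℝ, Integrable v mIoo → (∀ x, 0 ≤ v x) → (∀ x, v x ≤ ‖u x‖) →
      ∫⁻ t, ENNReal.ofReal (4 * ‖truncT ε (fun x => (v x : ℂ)) t‖ ^ 2) ∂mIoo ≤
      ENNReal.ofReal (32 * Real.pi ^ 2 * B ^ 2) := by
    intro v hv h0 hle
    simp_rw [ENNReal.ofReal_mul (show (0 : ℝ) ≤ 4 by norm_num)]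
    rw [lintegral_const_mul' _ _ ENNReal.ofReal_ne_top,
      show 32 * Real.pi ^ 2 * B ^ 2 = 4 * (8 * Real.pi ^ 2 * B ^ 2) by ring,
      ENNReal.ofReal_mul (by norm_num)]
    gcongr
    exact (setLIntegral_le_lintegral _ _).trans
      (lintegral_truncT_ofReal_sq_le hv h0 (fun x => (hle x).trans (hB x)) hε)
  have hm : ∀ v : ℝ → ℝ, Integrable v mIoo →
      AEMeasurable (fun t => ENNReal.ofReal (4 * ‖truncT ε (fun x => (v x : ℂ)) t‖ ^ 2)) mIoo :=
    fun v hv => ((((aestronglyMeasurable_truncT hv.ofReal.aestronglyMeasurable ε).norm.pow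
      2).const_mul 4).aemeasurable.ennreal_ofReal)
  have p1 : Integrable (fun x => max (u x).re 0) mIoo := hui.re.pos_part
  have p2 : Integrable (fun x => max (-(u x).re) 0) mIoo := hui.re.neg_part
  have p3 : Integrable (fun x => max (u x).im 0) mIoo := hui.im.pos_part
  have p4 : Integrable (fun x => max (-(u x).im) 0) mIoo := hui.im.neg_part
  calc ∫⁻ t, ENNReal.ofReal (‖truncT ε u t‖ ^ 2) ∂mIoo
      ≤ ∫⁻ t, (ENNReal.ofReal (4 * ‖truncT ε (fun x => ((max (u x).re 0 : ℝ) : ℂ)) t‖ ^ 2) +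
      (ENNReal.ofReal (4 * ‖truncT ε (fun x => ((max (-(u x).re) 0 : ℝ) : ℂ)) t‖ ^ 2) +
      (ENNReal.ofReal (4 * ‖truncT ε (fun x => ((max (u x).im 0 : ℝ) : ℂ)) t‖ ^ 2) +
      ENNReal.ofReal (4 * ‖truncT ε (fun x => ((max (-(u x).im) 0 : ℝ) : ℂ)) t‖ ^ 2)))) ∂mIoo := by
        refine lintegral_mono fun t => ?_
        simp only
        rw [← ENNReal.ofReal_add (by positivity) (by positivity),
          ← ENNReal.ofReal_add (by positivity) (by positivity),
          ← ENNReal.ofReal_add (by positivity) (by positivity)]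
        refine ENNReal.ofReal_le_ofReal ?_
        refine (pow_le_pow_left₀ (norm_nonneg _) (norm_truncT_le_parts hui hε t) 2).trans ?_
        generalize ‖truncT ε (fun x => ((max (u x).re 0 : ℝ) : ℂ)) t‖ = a
        generalize ‖truncT ε (fun x => ((max (-(u x).re) 0 : ℝ) : ℂ)) t‖ = b
        generalize ‖truncT ε (fun x => ((max (u x).im 0 : ℝ) : ℂ)) t‖ = c
        generalize ‖truncT ε (fun x => ((max (-(u x).im) 0 : ℝ) : ℂ)) t‖ = d
        nlinarith [sq_nonneg (a - b), sq_nonneg (a - c), sq_nonneg (a - d), sq_nonneg (b - c),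
          sq_nonneg (b - d), sq_nonneg (c - d)]
    _ ≤ _ := by
        rw [lintegral_add_left' (hm _ p1), lintegral_add_left' (hm _ p2),
          lintegral_add_left' (hm _ p3),
          show 128 * Real.pi ^ 2 * B ^ 2 = 32 * Real.pi ^ 2 * B ^ 2 + (32 * Real.pi ^ 2 * B ^ 2 +
            (32 * Real.pi ^ 2 * B ^ 2 + 32 * Real.pi ^ 2 * B ^ 2)) by ring,
          ENNReal.ofReal_add (by positivity) (by positivity),
          ENNReal.ofReal_add (by positivity) (by positivity),
          ENNReal.ofReal_add (by positivity) (by positivity)]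
        refine add_le_add (key _ p1 (fun x => le_max_right _ _) fun x => (part_le_norm (u x)).1)
          (add_le_add (key _ p2 (fun x => le_max_right _ _) fun x => (part_le_norm (u x)).2.1)
          (add_le_add (key _ p3 (fun x => le_max_right _ _) fun x => (part_le_norm (u x)).2.2.1)
          (key _ p4 (fun x => le_max_right _ _) fun x => (part_le_norm (u x)).2.2.2)))

theorem integrable_of_lintegral_sq_le {α : Type*} {m : MeasurableSpace α} {μ : Measure α}
    [IsFiniteMeasure μ] {G : α → ℂ} {M : ℝ} (hG : AEStronglyMeasurable G μ)
    (hM : ∫⁻ x, ENNReal.ofReal (‖G x‖ ^ 2) ∂μ ≤ ENNReal.ofReal M) : Integrable G μ := by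
  refine ((memLp_two_iff_integrable_sq_norm hG).2 ⟨(hG.norm.pow 2), ?_⟩).integrable one_le_two
  rw [hasFiniteIntegral_iff_ofReal (Eventually.of_forall fun x => sq_nonneg _)]
  exact hM.trans_lt ENNReal.ofReal_lt_top

/-- Vitali convergence for an `L²`-bounded sequence. -/
theorem tendsto_integral_of_sq_bounded {α : Type*} {m : MeasurableSpace α} {μ : Measure α}
    [IsFiniteMeasure μ] {F : ℕ → α → ℂ} {G : α → ℂ} {M : ℝ} (hM0 : 0 ≤ M)
    (hF : ∀ n, AEStronglyMeasurable (F n) μ)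
    (hM : ∀ n, ∫⁻ x, ENNReal.ofReal (‖F n x‖ ^ 2) ∂μ ≤ ENNReal.ofReal M)
    (hlim : ∀ᵐ x ∂μ, Tendsto (fun n => F n x) atTop (𝓝 (G x))) :
    Integrable G μ ∧ Tendsto (fun n => ∫ x, F n x ∂μ) atTop (𝓝 (∫ x, G x ∂μ)) := by
  have hG : AEStronglyMeasurable G μ := aestronglyMeasurable_of_tendsto_ae atTop hF hlim
  have hGi : Integrable G μ := by
    refine integrable_of_lintegral_sq_le hG (lintegral_le_of_ae_tendsto
      (fun n => ((hF n).norm.pow 2).aemeasurable.ennreal_ofReal) hM ?_)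
    filter_upwards [hlim] with x hx
    exact ENNReal.tendsto_ofReal (hx.norm.pow 2)
  refine ⟨hGi, tendsto_integral_of_L1' G hG
    (Eventually.of_forall fun n => integrable_of_lintegral_sq_le (hF n) (hM n))
    (tendsto_Lp_finite_of_tendsto_ae le_rfl ENNReal.one_ne_top hF
      (memLp_one_iff_integrable.2 hGi) ?_ hlim)⟩
  refine unifIntegrable_of le_rfl ENNReal.one_ne_top hF fun ε hε => ?_
  have hC : 0 < M / ε + 1 := by positivity
  refine ⟨⟨M / ε + 1, hC.le⟩, fun n => ?_⟩
  rw [eLpNorm_one_eq_lintegral_enorm]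
  calc ∫⁻ x, ‖({x | (⟨M / ε + 1, hC.le⟩ : NNReal) ≤ ‖F n x‖₊}.indicator (F n)) x‖ₑ ∂μ
      ≤ ∫⁻ x, ENNReal.ofReal (1 / (M / ε + 1)) * ENNReal.ofReal (‖F n x‖ ^ 2) ∂μ := by
        refine lintegral_mono fun x => ?_
        by_cases hx : (⟨M / ε + 1, hC.le⟩ : NNReal) ≤ ‖F n x‖₊
        · simp only
          rw [indicator_of_mem (by exact hx), ← ofReal_norm, ← ENNReal.ofReal_mul (by positivity)]
          refine ENNReal.ofReal_le_ofReal ?_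
          have hx' : M / ε + 1 ≤ ‖F n x‖ := hx
          rw [one_div_mul_eq_div, le_div_iff₀ hC, sq]
          exact mul_le_mul_of_nonneg_left hx' (norm_nonneg _)
        · rw [indicator_of_notMem (by exact hx)]
          simp
    _ = ENNReal.ofReal (1 / (M / ε + 1)) * ∫⁻ x, ENNReal.ofReal (‖F n x‖ ^ 2) ∂μ :=
        lintegral_const_mul' _ _ ENNReal.ofReal_ne_top
    _ ≤ ENNReal.ofReal (1 / (M / ε + 1)) * ENNReal.ofReal M := by
        gcongr
        exact hM n
    _ ≤ ENNReal.ofReal ε := by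
        rw [← ENNReal.ofReal_mul (by positivity)]
        refine ENNReal.ofReal_le_ofReal ?_
        rw [one_div_mul_eq_div, div_le_iff₀ hC, mul_add, mul_div_cancel₀ _ hε.ne']
        linarith

theorem integral_mul_truncT {u v : ℝ → ℂ} (hu : Integrable u mIoo) (hv : Integrable v mIoo)
    {ε : ℝ} (hε : 0 < ε) :
    ∫ t, v t * truncT ε u t ∂mIoo = -∫ t, u t * truncT ε v t ∂mIoo := by
  have hi : Integrable (Function.uncurry fun t x : ℝ => v t * (u x * (truncKernel ε (x - t) : ℂ)))
      (mIoo.prod mIoo) := by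
    refine ((hv.norm.mul_prod hu.norm).mul_const ε⁻¹).mono'
      (aestronglyMeasurable_mul_truncKernel hu.aestronglyMeasurable hv.aestronglyMeasurable ε)
      (Eventually.of_forall fun p => ?_)
    simp only [Function.uncurry, norm_mul, Complex.norm_real, Real.norm_eq_abs]
    rw [← mul_assoc]
    exact mul_le_mul_of_nonneg_left (abs_truncKernel_le hε _) (by positivity)
  simp only [truncT, ← integral_const_mul]
  rw [integral_integral_swap hi, ← integral_neg]
  refine integral_congr_ae (Eventually.of_forall fun x => ?_)
  simp only
  rw [← integral_neg]
  refine integral_congr_ae (Eventually.of_forall fun t => ?_)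
  simp only
  rw [← neg_sub t x, truncKernel_neg, Complex.ofReal_neg]
  ring

theorem tendsto_integral_mul_truncT {u v : ℝ → ℂ} {B : ℝ} (hu : AEStronglyMeasurable u mIoo)
    (huB : ∀ x, ‖u x‖ ≤ B) (hv : AEStronglyMeasurable v mIoo) (hvB : ∀ x, ‖v x‖ ≤ B) :
    Integrable (fun t => v t * FHT u t) mIoo ∧
    Tendsto (fun n : ℕ => (Real.pi : ℂ)⁻¹ * ∫ t, v t * truncT (1 / ((n : ℝ) + 1)) u t ∂mIoo) atTop
      (𝓝 (∫ t, v t * FHT u t ∂mIoo)) := by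
  have hui : Integrable u mIoo := Integrable.of_bound hu B (Eventually.of_forall huB)
  have hB : 0 ≤ B := (norm_nonneg _).trans (huB 0)
  have h := tendsto_integral_of_sq_bounded (μ := mIoo)
    (F := fun (n : ℕ) t => v t * ((Real.pi : ℂ)⁻¹ * truncT (1 / ((n : ℝ) + 1)) u t))
    (G := fun t => v t * FHT u t) (M := B ^ 2 * (128 * Real.pi ^ 2 * B ^ 2)) (by positivity)
    (fun n => hv.mul ((aestronglyMeasurable_truncT hu _).const_mul _)) (fun n => ?_) ?_
  · refine ⟨h.1, h.2.congr fun n => ?_⟩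
    rw [← integral_const_mul]
    refine integral_congr_ae (Eventually.of_forall fun t => ?_)
    simp only
    ring
  · rw [ENNReal.ofReal_mul (by positivity)]
    refine le_trans ?_ (mul_le_mul_right (lintegral_truncT_sq_le hu huB
      (show 0 < 1 / ((n : ℝ) + 1) by positivity)) _)
    rw [← lintegral_const_mul' _ _ ENNReal.ofReal_ne_top]
    refine lintegral_mono fun t => ?_
    simp only
    rw [← ENNReal.ofReal_mul (by positivity)]
    refine ENNReal.ofReal_le_ofReal ?_
    rw [norm_mul, norm_mul, mul_pow, norm_inv, Complex.norm_real, Real.norm_eq_abs,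
      abs_of_pos Real.pi_pos]
    have h3 : Real.pi⁻¹ ≤ 1 := inv_le_one_of_one_le₀ (by linarith [Real.two_le_pi])
    have := hvB t
    have h4 := mul_le_mul_of_nonneg_right h3 (norm_nonneg (truncT (1 / ((n : ℝ) + 1)) u t))
    rw [one_mul] at h4
    gcongr
  · filter_upwards [tendsto_truncT_FHT hui] with t ht
    exact (ht.comp tendsto_one_div_nhdsGT).const_mul (v t)

/-- Parseval formula for bounded functions. -/
theorem integral_mul_FHT_of_bounded {u v : ℝ → ℂ} {B : ℝ} (hu : AEStronglyMeasurable u mIoo)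
    (huB : ∀ x, ‖u x‖ ≤ B) (hv : AEStronglyMeasurable v mIoo) (hvB : ∀ x, ‖v x‖ ≤ B) :
    ∫ t, v t * FHT u t ∂mIoo = -∫ t, u t * FHT v t ∂mIoo := by
  refine tendsto_nhds_unique (tendsto_integral_mul_truncT hu huB hv hvB).2
    ((tendsto_integral_mul_truncT hv hvB hu huB).2.neg.congr fun n => ?_)
  rw [integral_mul_truncT (Integrable.of_bound hu B (Eventually.of_forall huB))
    (Integrable.of_bound hv B (Eventually.of_forall hvB)) (show 0 < 1 / ((n : ℝ) + 1) by positivity)]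
  ring

theorem aestronglyMeasurable_cut {u : ℝ → ℂ} (hu : AEStronglyMeasurable u mIoo) (n : ℕ) :
    AEStronglyMeasurable ({x | ‖u x‖ ≤ n}.indicator u) mIoo :=
  hu.indicator₀ (nullMeasurableSet_le hu.norm.aemeasurable aemeasurable_const)

theorem norm_cut_le (u : ℝ → ℂ) (n : ℕ) (x : ℝ) : ‖{x | ‖u x‖ ≤ n}.indicator u x‖ ≤ n := by
  by_cases h : ‖u x‖ ≤ n
  · rwa [indicator_of_mem (by exact h)]
  · rw [indicator_of_notMem (by exact h), norm_zero]
    exact n.cast_nonneg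

theorem tendsto_integral_cut_sub {u : ℝ → ℂ} (hu : Integrable u mIoo) :
    Tendsto (fun n : ℕ => ∫ x, ‖{x | ‖u x‖ ≤ n}.indicator u x - u x‖ ∂mIoo) atTop (𝓝 0) := by
  rw [← integral_zero ℝ ℝ (μ := mIoo)]
  refine tendsto_integral_of_dominated_convergence (fun x => ‖u x‖)
    (fun n => ((aestronglyMeasurable_cut hu.1 n).sub hu.1).norm) hu.norm
    (fun n => Eventually.of_forall fun x => ?_) (Eventually.of_forall fun x => ?_)
  · rw [norm_norm]
    by_cases h : ‖u x‖ ≤ n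
    · rw [indicator_of_mem (by exact h), sub_self, norm_zero]
      exact norm_nonneg _
    · rw [indicator_of_notMem (by exact h), zero_sub, norm_neg]
  · refine tendsto_const_nhds.congr' ?_
    filter_upwards [eventually_ge_atTop ⌈‖u x‖⌉₊] with n hn
    rw [indicator_of_mem (by exact Nat.ceil_le.1 hn), sub_self, norm_zero]

/-- An exhaustion of `(-1, 1)` on which `T u` is bounded and can be paired with bounded functions. -/
theorem exists_exhaustion {u : ℝ → ℂ} (hu : Integrable u mIoo) :
    ∃ E : ℕ → Set ℝ, Monotone E ∧ (∀ n, MeasurableSet (E n)) ∧ (∀ᵐ t ∂mIoo, ∃ n, t ∈ E n) ∧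
      (∀ n : ℕ, ∀ᵐ t ∂mIoo, t ∈ E n → ‖FHT u t‖ ≤ n) ∧
      ∀ (n : ℕ) (v : ℝ → ℂ) (B : ℝ), AEStronglyMeasurable v mIoo → (∀ x, ‖v x‖ ≤ B) →
        (∀ x ∉ E n, v x = 0) →
        ‖∫ t, v t * FHT u t ∂mIoo‖ₑ ≤ ∫⁻ x, ‖u x‖ₑ * ‖FHT v x‖ₑ ∂mIoo := by
  have hcm := aestronglyMeasurable_cut hu.1
  have hci : ∀ n : ℕ, Integrable ({x | ‖u x‖ ≤ n}.indicator u) mIoo := fun n =>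
    Integrable.of_bound (hcm n) n (Eventually.of_forall (norm_cut_le u n))
  obtain ⟨ns, -, hns⟩ := exists_subseq_tendsto_FHT hci hu (tendsto_integral_cut_sub hu)
  set c : ℕ → ℝ → ℂ := fun i => {x | ‖u x‖ ≤ ns i}.indicator u with hc
  have hF : ∀ i, AEStronglyMeasurable (FHT (c i)) mIoo := fun i => aestronglyMeasurable_FHT (hci _)
  have hmk : ∀ᵐ t ∂mIoo, ∀ i, FHT (c i) t = (hF i).mk _ t := ae_all_iff.2 fun i => (hF i).ae_eq_mk
  refine ⟨fun n => {t | ∀ i, ‖(hF i).mk _ t‖ ≤ n}, ?_, ?_, ?_, ?_, ?_⟩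
  · exact fun m n hmn t ht i => (ht i).trans (Nat.cast_le.2 hmn)
  · intro n
    simp only [ofPred_forall]
    exact MeasurableSet.iInter fun i =>
      measurableSet_le (hF i).stronglyMeasurable_mk.norm.measurable measurable_const
  · filter_upwards [hmk, hns] with t h1 h2
    obtain ⟨C, hC⟩ := (Metric.isBounded_range_of_tendsto _ h2).exists_norm_le
    refine ⟨⌈C⌉₊, fun i => ?_⟩
    rw [← h1]
    exact (hC _ (mem_range_self i)).trans (Nat.le_ceil C)
  · intro n
    filter_upwards [hmk, hns] with t h1 h2 ht
    refine le_of_tendsto' h2.norm fun i => ?_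
    have := ht i
    rwa [← h1] at this
  · intro n v B hv hvB hvE
    have hB : 0 ≤ B := (norm_nonneg _).trans (hvB 0)
    have hlim : Tendsto (fun i => ∫ t, v t * FHT (c i) t ∂mIoo) atTop
        (𝓝 (∫ t, v t * FHT u t ∂mIoo)) := by
      refine tendsto_integral_of_dominated_convergence (fun _ => B * n)
        (fun i => hv.mul (hF i)) (integrable_const _) (fun i => ?_) ?_
      · filter_upwards [hmk] with t h1
        by_cases ht : ∀ i, ‖(hF i).mk _ t‖ ≤ n
        · rw [norm_mul, h1]
          exact mul_le_mul (hvB t) (ht i) (norm_nonneg _) hB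
        · rw [hvE t ht, zero_mul, norm_zero]
          positivity
      · filter_upwards [hns] with t h2
        exact h2.const_mul _
    refine le_of_tendsto' ((continuous_enorm.tendsto _).comp hlim) fun i => ?_
    simp only [Function.comp_apply]
    rw [integral_mul_FHT_of_bounded (B := max B (ns i)) (hcm _)
      (fun x => (norm_cut_le u _ x).trans (le_max_right _ _)) hv
      (fun x => (hvB x).trans (le_max_left _ _)), enorm_neg]
    refine (enorm_integral_le_lintegral_enorm _).trans (lintegral_mono fun t => ?_)
    simp only
    rw [enorm_mul]
    gcongr
    exact enorm_indicator_le_enorm_self _ _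

/-- A Baire category argument on the Cantor space of subseries of a family of functions. -/
theorem exists_uniform_bound_of_forall {U : (ℕ → Bool) → ℝ → ℂ} (hU : ∀ σ, Integrable (U σ) mIoo)
    (hc : ∀ (σ : ℕ → Bool) (s : ℕ → ℕ → Bool), Tendsto s atTop (𝓝 σ) →
      Tendsto (fun n => ∫ x, ‖U (s n) x - U σ x‖ ∂mIoo) atTop (𝓝 0))
    {θ : ℕ → ℝ → ℝ → ℝ≥0∞} (hθc : ∀ N x, Continuous (θ N x))
    (hθm : ∀ N (F : ℝ → ℂ), AEStronglyMeasurable F mIoo →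
      AEMeasurable (fun x => θ N x ‖F x‖) mIoo)
    (h : ∀ σ, ∃ N : ℕ, ∫⁻ x, θ N x ‖FHT (U σ) x‖ ∂mIoo ≤ N) :
    ∃ N m : ℕ, ∃ σ : ℕ → Bool, ∀ k ≥ m, ∀ b : Bool,
      ∫⁻ x, θ N x ‖FHT (U (Function.update σ k b)) x‖ ∂mIoo ≤ N := by
  have hclosed : ∀ N : ℕ, IsClosed {σ | ∫⁻ x, θ N x ‖FHT (U σ) x‖ ∂mIoo ≤ N} := by
    intro N
    refine IsSeqClosed.isClosed fun s σ hs hσ => ?_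
    obtain ⟨ns, -, hns⟩ := exists_subseq_tendsto_FHT (fun n => hU (s n)) (hU σ) (hc σ s hσ)
    refine lintegral_le_of_ae_tendsto (F := fun i x => θ N x ‖FHT (U (s (ns i))) x‖)
      (fun i => hθm N _ (aestronglyMeasurable_FHT (hU _))) (fun i => hs (ns i)) ?_
    filter_upwards [hns] with t ht
    exact ((hθc N t).tendsto _).comp ht.norm
  obtain ⟨N, σ, hσ⟩ := nonempty_interior_of_iUnion_of_closed hclosed
    (eq_univ_of_forall fun σ => mem_iUnion.2 (h σ))
  obtain ⟨V, hV, hVo, hσV⟩ := mem_interior.1 hσ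
  obtain ⟨I, W, hW, hIW⟩ := isOpen_pi_iff.1 hVo σ hσV
  refine ⟨N, I.sup id + 1, σ, fun k hk b => ?_⟩
  refine hV (hIW fun i hi => ?_)
  have hik : i ≠ k := by
    have : i ≤ I.sup id := Finset.le_sup (f := id) hi
    omega
  rw [Function.update_of_ne hik]
  exact (hW i hi).2

theorem exists_strictMono_of_step {P : ℕ → ℕ → ℕ → Prop} (h : ∀ k n, ∃ m > n, P k n m) :
    ∃ ns : ℕ → ℕ, StrictMono ns ∧ ∀ k, P k (ns k) (ns (k + 1)) := by
  choose φ hφ hP using h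
  let ns : ℕ → ℕ := fun k => Nat.rec 0 (fun k n => φ k n) k
  exact ⟨ns, strictMono_nat_of_lt_succ fun k => hφ k (ns k), fun k => hP k (ns k)⟩

theorem pairwise_disjoint_sdiff_of_monotone {E : ℕ → Set ℝ} (hE : Monotone E) {ns : ℕ → ℕ}
    (hns : StrictMono ns) :
    Pairwise (Function.onFun Disjoint fun k => E (ns (k + 1)) \ E (ns k)) := by
  refine (pairwise_disjoint_on _).2 fun j k hjk => ?_
  refine disjoint_left.2 fun x hx hx' => hx'.2 (hE (hns.monotone hjk) hx.1)

theorem exists_le_setLIntegral_sdiff {E : ℕ → Set ℝ} (hE : Monotone E)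
    (hEm : ∀ n, MeasurableSet (E n)) {μ : Measure ℝ} {ρ : ℝ → ℝ≥0∞}
    (hfin : ∀ n, ∫⁻ x in E n, ρ x ∂μ < ⊤) (htop : ∫⁻ x in ⋃ n, E n, ρ x ∂μ = ⊤) (C n : ℕ) :
    ∃ m > n, (C : ℝ≥0∞) ≤ ∫⁻ x in E m \ E n, ρ x ∂μ := by
  have h1 : Tendsto (fun m => ∫⁻ x in E m, ρ x ∂μ) atTop (𝓝 ⊤) := by
    have := tendsto_measure_iUnion_atTop (μ := μ.withDensity ρ) hE
    rw [withDensity_apply _ (MeasurableSet.iUnion hEm), htop] at this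
    refine this.congr fun m => ?_
    exact withDensity_apply _ (hEm m)
  have h2 := h1.eventually (lt_mem_nhds
    (show (C : ℝ≥0∞) + ∫⁻ x in E n, ρ x ∂μ < ⊤ from
      ENNReal.add_lt_top.2 ⟨ENNReal.natCast_lt_top C, hfin n⟩))
  obtain ⟨m, hm, hnm⟩ := (h2.and (eventually_gt_atTop n)).exists
  refine ⟨m, hnm, ?_⟩
  have h3 : ∫⁻ x in E m, ρ x ∂μ ≤ ∫⁻ x in E m \ E n, ρ x ∂μ + ∫⁻ x in E n, ρ x ∂μ := by
    rw [← lintegral_inter_add_sdiff ρ (E m) (hEm n), add_comm]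
    gcongr
    exact inter_subset_right
  exact (ENNReal.add_le_add_iff_right (hfin n).ne).1 (hm.le.trans h3)

/-- A gliding hump lemma for the finite Hilbert transform. -/
theorem exists_uniform_bound_blocks {B : ℕ → Set ℝ} (hBm : ∀ k, MeasurableSet (B k))
    (hBd : Pairwise (Function.onFun Disjoint B)) {f : ℝ → ℂ} (hf : Integrable f mIoo)
    {θ : ℕ → ℝ → ℝ → ℝ≥0∞} (hθc : ∀ N x, Continuous (θ N x))
    (hθm : ∀ N (F : ℝ → ℂ), AEStronglyMeasurable F mIoo →
      AEMeasurable (fun x => θ N x ‖F x‖) mIoo)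
    (h : ∀ A, MeasurableSet A → ∃ N : ℕ, ∫⁻ x, θ N x ‖FHT (A.indicator f) x‖ ∂mIoo ≤ N) :
    ∃ N m : ℕ, ∀ k ≥ m, ∃ G G' : ℝ → ℂ, AEStronglyMeasurable G mIoo ∧ AEStronglyMeasurable G' mIoo ∧
      (FHT ((B k).indicator f) =ᵐ[mIoo] fun x => G x - G' x) ∧
      ∫⁻ x, θ N x ‖G x‖ ∂mIoo ≤ N ∧ ∫⁻ x, θ N x ‖G' x‖ ∂mIoo ≤ N := by
  classical
  have huniq : ∀ {x k j}, x ∈ B k → x ∈ B j → j = k := fun {x k j} hk hj => by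
    by_contra hne
    exact disjoint_left.1 (hBd hne) hj hk
  set S : (ℕ → Bool) → Set ℝ := fun σ => {x | ∃ k, σ k = true ∧ x ∈ B k} with hS
  have hSm : ∀ σ, MeasurableSet (S σ) := fun σ => by
    simp only [hS, ofPred_exists]
    exact MeasurableSet.iUnion fun k => (MeasurableSet.const _).inter (hBm k)
  have hmem : ∀ {x k}, x ∈ B k → ∀ σ, x ∈ S σ ↔ σ k = true := fun {x k} hx σ =>
    ⟨fun ⟨j, hj, hxj⟩ => huniq hx hxj ▸ hj, fun h => ⟨k, h, hx⟩⟩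
  have hnot : ∀ {x}, (¬∃ j, x ∈ B j) → ∀ σ, x ∉ S σ := fun {x} hx σ ⟨j, _, hj⟩ => hx ⟨j, hj⟩
  have hU : ∀ σ, Integrable ((S σ).indicator f) mIoo := fun σ => hf.indicator (hSm σ)
  have hcont : ∀ (σ : ℕ → Bool) (s : ℕ → ℕ → Bool), Tendsto s atTop (𝓝 σ) →
      Tendsto (fun n => ∫ x, ‖(S (s n)).indicator f x - (S σ).indicator f x‖ ∂mIoo) atTop (𝓝 0) := by
    intro σ s hs
    rw [← integral_zero ℝ ℝ (μ := mIoo)]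
    refine tendsto_integral_of_dominated_convergence (fun x => ‖f x‖ + ‖f x‖)
      (fun n => ((hU (s n)).sub (hU σ)).1.norm) (hf.norm.add hf.norm)
      (fun n => Eventually.of_forall fun x => ?_) (Eventually.of_forall fun x => ?_)
    · rw [norm_norm]
      exact (norm_sub_le _ _).trans (add_le_add (norm_indicator_le_norm_self _ _)
        (norm_indicator_le_norm_self _ _))
    · refine tendsto_const_nhds.congr' ?_
      by_cases hx : ∃ j, x ∈ B j
      · obtain ⟨j, hj⟩ := hx
        have h1 : ∀ᶠ n in atTop, s n j = σ j := by
          have := (tendsto_pi_nhds.1 hs j)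
          rw [nhds_discrete] at this
          exact tendsto_pure.1 this
        filter_upwards [h1] with n hn
        simp only [indicator, hmem hj, hn, sub_self, norm_zero]
      · refine Eventually.of_forall fun n => ?_
        simp only [indicator, hnot hx, if_false, sub_self, norm_zero]
  obtain ⟨N, m, σ, hσ⟩ := exists_uniform_bound_of_forall hU hcont hθc hθm fun σ => h _ (hSm σ)
  refine ⟨N, m, fun k hk => ⟨_, _, aestronglyMeasurable_FHT (hU (Function.update σ k true)),
    aestronglyMeasurable_FHT (hU (Function.update σ k false)), ?_, hσ k hk true, hσ k hk false⟩⟩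
  have heq : (B k).indicator f = fun x => (S (Function.update σ k true)).indicator f x -
      (S (Function.update σ k false)).indicator f x := by
    funext x
    by_cases hx : ∃ j, x ∈ B j
    · obtain ⟨j, hj⟩ := hx
      by_cases hjk : j = k
      · subst hjk
        rw [indicator_of_mem hj, indicator_of_mem ((hmem hj _).2 (by simp)),
          indicator_of_notMem (fun h => by simpa using (hmem hj _).1 h), sub_zero]
      · rw [indicator_of_notMem (fun h => hjk (huniq h hj))]
        simp only [indicator, hmem hj, Function.update_of_ne hjk, sub_self]
    · rw [indicator_of_notMem (fun h => hx ⟨k, h⟩),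
        indicator_of_notMem (hnot hx _),
        indicator_of_notMem (hnot hx _), sub_zero]
  rw [heq]
  exact FHT_sub_ae (hU _) (hU _)

theorem mul_le_mul_log_add_exp {s : ℝ} (hs : 0 ≤ s) (t : ℝ) :
    s * t ≤ s * Real.log (2 + s) + Real.exp t := by
  rcases hs.eq_or_lt with rfl | hs'
  · simpa using (Real.exp_pos t).le
  · have h1 := Real.add_one_le_exp (t - Real.log s)
    rw [Real.exp_sub, Real.exp_log hs', le_div_iff₀ hs'] at h1
    have h2 : Real.log s ≤ Real.log (2 + s) := Real.log_le_log hs' (by linarith)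
    nlinarith

theorem MemLlogL.integrable {g : ℝ → ℂ} (hg : MemLlogL g) : Integrable g mIoo := by
  refine (hg.2.const_mul (Real.log 2)⁻¹).mono' hg.1 (Eventually.of_forall fun x => ?_)
  have h2 : 0 < Real.log 2 := Real.log_pos one_lt_two
  have h3 : Real.log 2 ≤ Real.log (2 + ‖g x‖) :=
    Real.log_le_log two_pos (by linarith [norm_nonneg (g x)])
  rw [inv_mul_eq_div, le_div_iff₀ h2]
  gcongr

theorem exists_lintegral_exp_le {F : ℝ → ℂ} (hF : MemLexp F) :
    ∃ N : ℕ, ∫⁻ x, ENNReal.ofReal (Real.exp (‖F x‖ / ((N : ℝ) + 1))) ∂mIoo ≤ N := by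
  obtain ⟨-, l, hl, hfin⟩ := hF
  obtain ⟨n, hn⟩ := exists_nat_one_div_lt hl
  obtain ⟨k, hk⟩ := ENNReal.exists_nat_gt hfin.ne
  refine ⟨max n k, le_trans (lintegral_mono fun x => ?_)
    (hk.le.trans (Nat.cast_le.2 (le_max_right n k)))⟩
  refine ENNReal.ofReal_le_ofReal (Real.exp_le_exp.2 ?_)
  rw [div_eq_mul_one_div, mul_comm]
  refine mul_le_mul_of_nonneg_right (le_trans ?_ hn.le) (norm_nonneg _)
  refine one_div_le_one_div_of_le (by positivity) ?_
  gcongr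
  exact_mod_cast le_max_left n k

theorem integrable_of_lintegral_re_mul_lt_top {α : Type*} {m : MeasurableSpace α} {μ : Measure α}
    {z : α → ℂ} (hz : AEStronglyMeasurable z μ)
    (h : ∀ a : ℂ, ‖a‖ = 1 → ∫⁻ x, ENNReal.ofReal (a * z x).re ∂μ < ⊤) : Integrable z μ := by
  have key : ∀ a : ℂ, ‖a‖ = 1 → Integrable (fun x => (a * z x).re) μ := by
    intro a ha
    refine ⟨Complex.continuous_re.comp_aestronglyMeasurable (hz.const_mul a), ?_⟩
    have h1 := h a ha
    have h2 := h (-a) (by rwa [norm_neg])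
    refine lt_of_le_of_lt ?_ (ENNReal.add_lt_top.2 ⟨h1, h2⟩)
    rw [← lintegral_add_left' ((Complex.continuous_re.comp_aestronglyMeasurable
      (hz.const_mul a)).aemeasurable.ennreal_ofReal)]
    refine lintegral_mono fun x => ?_
    rw [neg_mul, Complex.neg_re, Real.enorm_eq_ofReal_abs]
    rcases abs_cases (a * z x).re with ⟨h, -⟩ | ⟨h, -⟩ <;> rw [h]
    · exact le_self_add
    · exact le_add_self
  have hre := key 1 norm_one
  have him := key (-Complex.I) (by simp)
  refine (hre.ofReal.add (him.ofReal.mul_const Complex.I)).congr (Eventually.of_forall fun x => ?_)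
  have h1 : (-Complex.I * z x).re = (z x).im := by simp
  simp only [Pi.add_apply, h1, one_mul]
  exact Complex.re_add_im (z x)

theorem continuous_exp_div (N : ℕ) :
    Continuous fun r : ℝ => ENNReal.ofReal (Real.exp (r / ((N : ℝ) + 1))) :=
  ENNReal.continuous_ofReal.comp (Real.continuous_exp.comp (continuous_id.div_const _))

theorem lintegral_mul_le_of_exp {g G G' V : ℝ → ℂ} (hg : MemLlogL g)
    (hG : AEStronglyMeasurable G mIoo)
    (hV : V =ᵐ[mIoo] fun x => G x - G' x) {N : ℕ}
    (h : ∫⁻ x, ENNReal.ofReal (Real.exp (‖G x‖ / ((N : ℝ) + 1))) ∂mIoo ≤ N)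
    (h' : ∫⁻ x, ENNReal.ofReal (Real.exp (‖G' x‖ / ((N : ℝ) + 1))) ∂mIoo ≤ N) :
    ∫⁻ x, ‖g x‖ₑ * ‖V x‖ₑ ∂mIoo ≤ ENNReal.ofReal (2 * ((N : ℝ) + 1)) *
      (∫⁻ x, ENNReal.ofReal (‖g x‖ * Real.log (2 + ‖g x‖)) ∂mIoo + (N + N)) := by
  have hm : AEMeasurable (fun x => ENNReal.ofReal (Real.exp (‖G x‖ / ((N : ℝ) + 1)))) mIoo :=
    (continuous_exp_div N).measurable.comp_aemeasurable hG.norm.aemeasurable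
  refine le_trans ?_ (mul_le_mul_right (add_le_add_right (add_le_add h h') _) _)
  rw [← lintegral_add_left' hm, ← lintegral_add_left' hg.2.1.aemeasurable.ennreal_ofReal,
    ← lintegral_const_mul' _ _ ENNReal.ofReal_ne_top]
  refine lintegral_mono_ae ?_
  filter_upwards [hV] with x hx
  have hlog : 0 ≤ Real.log (2 + ‖g x‖) := Real.log_nonneg (by linarith [norm_nonneg (g x)])
  rw [← ofReal_norm, ← ofReal_norm, ← ENNReal.ofReal_mul (norm_nonneg _),
    ← ENNReal.ofReal_add (Real.exp_pos _).le (Real.exp_pos _).le,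
    ← ENNReal.ofReal_add (by positivity) (by positivity), ← ENNReal.ofReal_mul (by positivity)]
  refine ENNReal.ofReal_le_ofReal ?_
  have hN : (0 : ℝ) < 2 * ((N : ℝ) + 1) := by positivity
  have h1 := mul_le_mul_log_add_exp (norm_nonneg (g x)) (‖V x‖ / (2 * ((N : ℝ) + 1)))
  have h2 : Real.exp (‖V x‖ / (2 * ((N : ℝ) + 1))) ≤
      Real.exp (‖G x‖ / ((N : ℝ) + 1)) + Real.exp (‖G' x‖ / ((N : ℝ) + 1)) := by
    have h3 : ‖V x‖ / (2 * ((N : ℝ) + 1)) ≤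
        max (‖G x‖ / ((N : ℝ) + 1)) (‖G' x‖ / ((N : ℝ) + 1)) := by
      rw [max_div_div_right (by positivity), div_le_div_iff₀ hN (by positivity)]
      have h4 : ‖V x‖ ≤ 2 * max ‖G x‖ ‖G' x‖ := by
        rw [hx]
        linarith [norm_sub_le (G x) (G' x), le_max_left ‖G x‖ ‖G' x‖, le_max_right ‖G x‖ ‖G' x‖]
      have h5 : (0 : ℝ) ≤ (N : ℝ) + 1 := by positivity
      nlinarith
    refine (Real.exp_le_exp.2 h3).trans ?_
    rcases max_cases (‖G x‖ / ((N : ℝ) + 1)) (‖G' x‖ / ((N : ℝ) + 1)) with ⟨h, -⟩ | ⟨h, -⟩ <;>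
      rw [h]
    · linarith [Real.exp_pos (‖G' x‖ / ((N : ℝ) + 1))]
    · linarith [Real.exp_pos (‖G x‖ / ((N : ℝ) + 1))]
  calc ‖g x‖ * ‖V x‖ = 2 * ((N : ℝ) + 1) * (‖g x‖ * (‖V x‖ / (2 * ((N : ℝ) + 1)))) := by
        field_simp
    _ ≤ _ := mul_le_mul_of_nonneg_left (by linarith) hN.le

theorem integrable_mul_FHT_of_memLexp_indicator {f : ℝ → ℂ} (hf : Integrable f mIoo)
    (hb : ∀ A : Set ℝ, MeasurableSet A → MemLexp (FHT (A.indicator f))) {g : ℝ → ℂ}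
    (hg : MemLlogL g) : Integrable (fun x => f x * FHT g x) mIoo := by
  classical
  have hgi := hg.integrable
  have hz : AEStronglyMeasurable (fun x => f x * FHT g x) mIoo :=
    hf.1.mul (aestronglyMeasurable_FHT hgi)
  refine integrable_of_lintegral_re_mul_lt_top hz fun a ha => lt_top_iff_ne_top.2 fun htop => ?_
  obtain ⟨E, hEmono, hEm, hEex, hEb, hEp⟩ := exists_exhaustion hgi
  have hzm := hz.ae_eq_mk
  obtain ⟨S, hS, hSm, hSz⟩ := (hf.1.ae_eq_mk.and hzm).exists_measurable_mem
  set z := hz.mk _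
  set fm := hf.1.mk _
  have hSz : ∀ x ∈ S, f x = fm x ∧ f x * FHT g x = z x := hSz
  have hrem : Measurable fun x => (a * z x).re :=
    Complex.measurable_re.comp (hz.stronglyMeasurable_mk.measurable.const_mul a)
  set E' : ℕ → Set ℝ := fun n => E n ∩ S ∩ {x | ‖fm x‖ ≤ n} ∩ {x | 0 < (a * z x).re} with hE'
  have hE'mono : Monotone E' := fun m n hmn x hx =>
    ⟨⟨⟨hEmono hmn hx.1.1.1, hx.1.1.2⟩, (show ‖fm x‖ ≤ n from le_trans hx.1.2 (Nat.cast_le.2 hmn))⟩, hx.2⟩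
  have hE'm : ∀ n, MeasurableSet (E' n) := fun n =>
    (((hEm n).inter hSm).inter (measurableSet_le hf.1.stronglyMeasurable_mk.norm.measurable
      measurable_const)).inter (measurableSet_lt measurable_const hrem)
  have hfb : ∀ n, ∀ x ∈ E' n, ‖f x‖ ≤ n := fun n x hx => by
    rw [(hSz x hx.1.1.2).1]
    exact hx.1.2
  have hpos : ∀ n, ∀ x ∈ E' n, 0 < (a * (f x * FHT g x)).re := fun n x hx => by
    rw [(hSz x hx.1.1.2).2]
    exact hx.2
  have hfin : ∀ n, ∫⁻ x in E' n, ENNReal.ofReal (a * (f x * FHT g x)).re ∂mIoo < ⊤ := by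
    intro n
    refine lt_of_le_of_lt (setLIntegral_mono_ae (g := fun _ => ENNReal.ofReal ((n : ℝ) * n))
      aemeasurable_const ?_) ?_
    · filter_upwards [hEb n] with x hx hxE
      refine ENNReal.ofReal_le_ofReal ((Complex.re_le_norm _).trans ?_)
      rw [norm_mul, norm_mul, ha, one_mul]
      exact mul_le_mul (hfb n x hxE) (hx hxE.1.1.1) (norm_nonneg _) n.cast_nonneg
    · rw [setLIntegral_const]
      exact ENNReal.mul_lt_top ENNReal.ofReal_lt_top (measure_lt_top _ _)
  have htop' : ∫⁻ x in ⋃ n, E' n, ENNReal.ofReal (a * (f x * FHT g x)).re ∂mIoo = ⊤ := by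
    rw [← htop, ← lintegral_indicator (MeasurableSet.iUnion hE'm)]
    refine lintegral_congr_ae ?_
    filter_upwards [hEex, hS] with x ⟨n, hn⟩ hxS
    by_cases hx : 0 < (a * z x).re
    · rw [indicator_of_mem]
      refine mem_iUnion.2 ⟨max n ⌈‖fm x‖⌉₊, ⟨⟨hEmono (le_max_left _ _) hn, hxS⟩, ?_⟩, hx⟩
      exact (show ‖fm x‖ ≤ _ from (Nat.le_ceil _).trans (Nat.cast_le.2 (le_max_right _ _)))
    · rw [indicator_apply, ENNReal.ofReal_of_nonpos, ite_self]
      rw [(hSz x hxS).2]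
      exact not_lt.1 hx
  obtain ⟨ns, hns, hP⟩ := exists_strictMono_of_step
    (fun k n => exists_le_setLIntegral_sdiff hE'mono hE'm hfin htop' k n)
  set B : ℕ → Set ℝ := fun k => E' (ns (k + 1)) \ E' (ns k) with hB
  have hBm : ∀ k, MeasurableSet (B k) := fun k => (hE'm _).diff (hE'm _)
  obtain ⟨N, m, hN⟩ := exists_uniform_bound_blocks hBm
    (pairwise_disjoint_sdiff_of_monotone hE'mono hns) hf
    (θ := fun N _ r => ENNReal.ofReal (Real.exp (r / ((N : ℝ) + 1))))
    (fun N _ => continuous_exp_div N)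
    (fun N F hF => (continuous_exp_div N).measurable.comp_aemeasurable hF.norm.aemeasurable)
    fun A hA => exists_lintegral_exp_le (hb A hA)
  have hK : ENNReal.ofReal (2 * ((N : ℝ) + 1)) *
      (∫⁻ x, ENNReal.ofReal (‖g x‖ * Real.log (2 + ‖g x‖)) ∂mIoo + (N + N)) < ⊤ := by
    have h0 : ∫⁻ x, ENNReal.ofReal (‖g x‖ * Real.log (2 + ‖g x‖)) ∂mIoo < ⊤ := by
      rw [← hasFiniteIntegral_iff_ofReal (Eventually.of_forall fun x =>
        mul_nonneg (norm_nonneg _) (Real.log_nonneg (by linarith [norm_nonneg (g x)])))]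
      exact hg.2.2
    exact ENNReal.mul_lt_top ENNReal.ofReal_lt_top (ENNReal.add_lt_top.2 ⟨h0,
      ENNReal.add_lt_top.2 ⟨ENNReal.natCast_lt_top N, ENNReal.natCast_lt_top N⟩⟩)
  obtain ⟨k₀, hk₀⟩ := ENNReal.exists_nat_gt hK.ne
  set k := max m k₀ with hk
  obtain ⟨G, G', hG, -, hGG, h1, h2⟩ := hN k (le_max_left _ _)
  have hup := lintegral_mul_le_of_exp hg hG hGG h1 h2
  have hp := hEp (ns (k + 1)) ((B k).indicator f) (ns (k + 1)) (hf.1.indicator (hBm k))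
    (fun x => by
      by_cases hx : x ∈ B k
      · rw [indicator_of_mem hx]
        exact hfb _ x hx.1
      · rw [indicator_of_notMem hx, norm_zero]
        exact Nat.cast_nonneg _)
    (fun x hx => indicator_of_notMem (fun h => hx h.1.1.1.1) f)
  refine absurd hk₀ (not_lt.2 ?_)
  refine le_trans (le_trans ?_ ((hP k).trans ?_)) (hp.trans hup)
  · exact_mod_cast le_max_right m k₀
  · have hint : IntegrableOn (fun x => f x * FHT g x) (B k) mIoo := by
      refine ⟨hz.restrict, ?_⟩
      rw [hasFiniteIntegral_iff_enorm]
      refine lt_of_le_of_lt (setLIntegral_mono_ae (g := fun _ => ENNReal.ofReal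
        ((ns (k + 1) : ℝ) * ns (k + 1))) aemeasurable_const ?_) ?_
      · filter_upwards [hEb (ns (k + 1))] with x hx hxB
        rw [← ofReal_norm]
        refine ENNReal.ofReal_le_ofReal ?_
        rw [norm_mul]
        exact mul_le_mul (hfb _ x hxB.1) (hx hxB.1.1.1.1) (norm_nonneg _) (Nat.cast_nonneg _)
      · rw [setLIntegral_const]
        exact ENNReal.mul_lt_top ENNReal.ofReal_lt_top (measure_lt_top _ _)
    have hI : ∫ t, (B k).indicator f t * FHT g t ∂mIoo = ∫ t in B k, f t * FHT g t ∂mIoo := by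
      rw [← integral_indicator (hBm k)]
      refine integral_congr_ae (Eventually.of_forall fun t => ?_)
      by_cases ht : t ∈ B k <;> simp [ht]
    have hre : ∫ x in B k, (a * (f x * FHT g x)).re ∂mIoo =
        (a * ∫ t in B k, f t * FHT g t ∂mIoo).re := by
      rw [← integral_const_mul]
      exact integral_re (hint.const_mul a)
    have hri : IntegrableOn (fun x => (a * (f x * FHT g x)).re) (B k) mIoo := (hint.const_mul a).re
    change ∫⁻ x in B k, _ ∂mIoo ≤ _
    rw [hI, ← ofReal_integral_eq_lintegral_ofReal hri, ← ofReal_norm]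
    · refine ENNReal.ofReal_le_ofReal ?_
      refine (le_of_eq hre).trans ((Complex.re_le_norm _).trans ?_)
      rw [norm_mul, ha, one_mul]
    · refine (ae_restrict_iff' (hBm k)).2 (Eventually.of_forall fun x hx => ?_)
      exact (hpos _ x hx.1).le

theorem mul_log_monotone {s t : ℝ} (hs : 0 ≤ s) (hst : s ≤ t) :
    s * Real.log (2 + s) ≤ t * Real.log (2 + t) :=
  mul_le_mul hst (Real.log_le_log (by linarith) (by linarith)) (Real.log_nonneg (by linarith))
    (hs.trans hst)

theorem memLlogL_iff {g : ℝ → ℂ} (hg : AEStronglyMeasurable g mIoo) :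
    MemLlogL g ↔ ∫⁻ x, ENNReal.ofReal (‖g x‖ * Real.log (2 + ‖g x‖)) ∂mIoo < ⊤ := by
  have hm : AEStronglyMeasurable (fun x => ‖g x‖ * Real.log (2 + ‖g x‖)) mIoo :=
    (hg.norm.aemeasurable.mul (Real.measurable_log.comp_aemeasurable
      (hg.norm.aemeasurable.const_add 2))).aestronglyMeasurable
  rw [← hasFiniteIntegral_iff_ofReal (Eventually.of_forall fun x =>
    mul_nonneg (norm_nonneg _) (Real.log_nonneg (by linarith [norm_nonneg (g x)])))]
  exact ⟨fun h => h.2.2, fun h => ⟨hg, hm, h⟩⟩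

theorem MemLlogL.indicator {g : ℝ → ℂ} (hg : MemLlogL g) {A : Set ℝ} (hA : MeasurableSet A) :
    MemLlogL (A.indicator g) := by
  rw [memLlogL_iff (hg.1.indicator hA)]
  refine lt_of_le_of_lt (lintegral_mono fun x => ?_) ((memLlogL_iff hg.1).1 hg)
  exact ENNReal.ofReal_le_ofReal
    (mul_log_monotone (norm_nonneg _) (norm_indicator_le_norm_self _ _))

theorem mul_exp_mul_log_le {c q t : ℝ} (hc0 : 0 ≤ c) (hc1 : c ≤ 1) (hq : 0 < q) (ht : 2 * q ≤ t) :
    c * Real.exp (t / q) * Real.log (2 + c * Real.exp (t / q)) ≤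
      2 / q * (c * (t * Real.exp (t / q))) := by
  have h2 : 2 ≤ t / q := by rwa [le_div_iff₀ hq]
  have h1 : 1 ≤ Real.exp (t / q) := Real.one_le_exp (by linarith)
  have h3 : Real.log (2 + c * Real.exp (t / q)) ≤ t / q + t / q := by
    rw [Real.log_le_iff_le_exp (by positivity), Real.exp_add]
    have h4 := Real.add_one_le_exp (t / q)
    nlinarith [Real.exp_pos (t / q)]
  calc _ ≤ c * Real.exp (t / q) * (t / q + t / q) := by gcongr
    _ = _ := by ring

theorem exists_test_function {B : Set ℝ} (hB : MeasurableSet B) {F : ℝ → ℂ} (hF : Measurable F)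
    {q C M : ℝ} (hq : 0 < q) (hC : 0 < C) (hlow : ∀ x ∈ B, 2 * q ≤ ‖F x‖)
    (hM : ∀ x ∈ B, ‖F x‖ ≤ M)
    (hJ : ENNReal.ofReal C ≤ ∫⁻ x in B, ENNReal.ofReal (‖F x‖ * Real.exp (‖F x‖ / q)) ∂mIoo) :
    ∃ v : ℝ → ℂ, ∃ b : ℝ, Measurable v ∧ 0 ≤ b ∧ (∀ x ∈ B, ‖v x‖ ≤ b) ∧
      ∫ x in B, v x * F x ∂mIoo = C ∧
      ∫⁻ x in B, ENNReal.ofReal (‖v x‖ * Real.log (2 + ‖v x‖)) ∂mIoo ≤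
        ENNReal.ofReal (2 / q * C) := by
  set ψ : ℝ → ℝ := fun x => ‖F x‖ * Real.exp (‖F x‖ / q) with hψ
  have hEm : Measurable fun x => Real.exp (‖F x‖ / q) :=
    Real.measurable_exp.comp (hF.norm.div_const q)
  have hψm : Measurable ψ := hF.norm.mul hEm
  have hψ0 : ∀ x, 0 ≤ ψ x := fun x => by positivity
  have hψi : IntegrableOn ψ B mIoo := by
    refine Integrable.of_bound hψm.aestronglyMeasurable (M * Real.exp (M / q)) ?_
    refine (ae_restrict_iff' hB).2 (Eventually.of_forall fun x hx => ?_)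
    have h1 := hM x hx
    have h0 : 0 ≤ M := (norm_nonneg _).trans h1
    rw [Real.norm_of_nonneg (hψ0 x)]
    simp only [hψ]
    gcongr
  set J := ∫ x in B, ψ x ∂mIoo with hJdef
  have hCJ : C ≤ J := by
    rw [← ofReal_integral_eq_lintegral_ofReal hψi (Eventually.of_forall hψ0)] at hJ
    exact (ENNReal.ofReal_le_ofReal_iff (integral_nonneg hψ0)).1 hJ
  have hJ0 : 0 < J := hC.trans_le hCJ
  set c := C / J with hc
  have hc0 : 0 ≤ c := by positivity
  have hc1 : c ≤ 1 := (div_le_one hJ0).2 hCJ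
  have hcJ : c * J = C := div_mul_cancel₀ _ hJ0.ne'
  set v : ℝ → ℂ := fun x => ((c * Real.exp (‖F x‖ / q) : ℝ) : ℂ) *
    ((starRingEnd ℂ) (F x) / (‖F x‖ : ℂ)) with hv
  have hpos : ∀ x ∈ B, 0 < ‖F x‖ := fun x hx => lt_of_lt_of_le (by positivity) (hlow x hx)
  have hvn : ∀ x ∈ B, ‖v x‖ = c * Real.exp (‖F x‖ / q) := by
    intro x hx
    rw [hv]
    simp only
    rw [norm_mul, norm_div, RCLike.norm_conj, Complex.norm_real, Complex.norm_real, norm_norm,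
      div_self (hpos x hx).ne', mul_one, Real.norm_of_nonneg (by positivity)]
  have hvF : ∀ x ∈ B, v x * F x = ((c * ψ x : ℝ) : ℂ) := by
    intro x hx
    have h0 : (‖F x‖ : ℂ) ≠ 0 := Complex.ofReal_ne_zero.2 (hpos x hx).ne'
    have h1 : (starRingEnd ℂ) (F x) * F x = (‖F x‖ : ℂ) * (‖F x‖ : ℂ) := by
      rw [mul_comm, Complex.mul_conj, Complex.normSq_eq_norm_sq]
      push_cast
      ring
    simp only [hv, hψ]
    rw [mul_assoc, div_mul_eq_mul_div ((starRingEnd ℂ) (F x)), h1, mul_div_assoc, div_self h0]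
    push_cast
    ring
  refine ⟨v, Real.exp (M / q), ?_, (Real.exp_pos _).le, fun x hx => ?_, ?_, ?_⟩
  · exact (Complex.measurable_ofReal.comp (hEm.const_mul c)).mul
      ((Complex.continuous_conj.measurable.comp hF).div (Complex.measurable_ofReal.comp hF.norm))
  · rw [hvn x hx]
    have := hM x hx
    calc c * Real.exp (‖F x‖ / q) ≤ 1 * Real.exp (M / q) := by gcongr
      _ = _ := one_mul _
  · rw [setIntegral_congr_fun hB hvF, integral_complex_ofReal, integral_const_mul, hcJ]
  · calc _ ≤ ∫⁻ x in B, ENNReal.ofReal (2 / q * (c * ψ x)) ∂mIoo := by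
          refine setLIntegral_mono' hB fun x hx => ENNReal.ofReal_le_ofReal ?_
          rw [hvn x hx]
          exact mul_exp_mul_log_le hc0 hc1 hq (hlow x hx)
      _ = ENNReal.ofReal (2 / q * C) := by
          rw [← ofReal_integral_eq_lintegral_ofReal ((hψi.const_mul c).const_mul (2 / q))
            (Eventually.of_forall fun x => by have := hψ0 x; positivity), integral_const_mul,
            integral_const_mul, hcJ]

theorem exists_glue {B : ℕ → Set ℝ} (hBm : ∀ k, MeasurableSet (B k))
    (hBd : Pairwise (Function.onFun Disjoint B)) {v : ℕ → ℝ → ℂ} (hv : ∀ k, Measurable (v k)) :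
    ∃ g : ℝ → ℂ, Measurable g ∧ (∀ k, EqOn g (v k) (B k)) ∧ ∀ x ∉ ⋃ k, B k, g x = 0 := by
  obtain ⟨g, hg, hgv⟩ := exists_measurable_piecewise B hBm v hv
    (hBd.mono fun i j h => by rw [Disjoint.inter_eq h]; exact eqOn_empty _ _)
  refine ⟨(⋃ k, B k).indicator g, hg.indicator (MeasurableSet.iUnion hBm), fun k x hx => ?_,
    fun x hx => indicator_of_notMem hx g⟩
  rw [indicator_of_mem (mem_iUnion.2 ⟨k, hx⟩)]
  exact hgv k hx

theorem lintegral_mul_exp_eq_top {F : ℝ → ℂ} {q : ℝ} (hq : 0 < q) (hFm : Measurable F)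
    (hF : ∫⁻ x, ENNReal.ofReal (Real.exp (1 / q * ‖F x‖)) ∂mIoo = ⊤) {p : ℝ} (hp : 1 ≤ p) :
    ∫⁻ x in {x | p < ‖F x‖}, ENNReal.ofReal (‖F x‖ * Real.exp (‖F x‖ / q)) ∂mIoo = ⊤ := by
  have hA : MeasurableSet {x | p < ‖F x‖} := measurableSet_lt measurable_const hFm.norm
  rw [← lintegral_add_compl _ hA, ENNReal.add_eq_top] at hF
  rcases hF with h | h
  · refine top_unique (h.symm.le.trans (setLIntegral_mono' hA fun x hx => ?_))
    refine ENNReal.ofReal_le_ofReal ?_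
    have hx' : p < ‖F x‖ := hx
    rw [one_div_mul_eq_div]
    exact le_mul_of_one_le_left (Real.exp_pos _).le (by linarith)
  · refine absurd h (lt_top_iff_ne_top.1 (lt_of_le_of_lt (setLIntegral_mono' hA.compl
      (g := fun _ => ENNReal.ofReal (Real.exp (p / q))) fun x hx => ?_) ?_))
    · have hx' : ‖F x‖ ≤ p := not_lt.1 hx
      rw [one_div_mul_eq_div]
      gcongr
    · rw [setLIntegral_const]
      exact ENNReal.mul_lt_top ENNReal.ofReal_lt_top (measure_lt_top _ _)

theorem memLexp_FHT_of_integrable_mul {f : ℝ → ℂ} (hf : Integrable f mIoo)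
    (hd : ∀ g : ℝ → ℂ, MemLlogL g → Integrable (fun x => f x * FHT g x) mIoo) {h : ℝ → ℂ}
    (hh : AEStronglyMeasurable h mIoo) (hhf : ∀ᵐ x ∂mIoo, ‖h x‖ ≤ ‖f x‖) : MemLexp (FHT h) := by
  have hhi : Integrable h mIoo := hf.mono hh hhf
  have hFa := aestronglyMeasurable_FHT hhi
  by_contra hcon
  obtain ⟨E, hEmono, hEm, hEex, -, hEp⟩ := exists_exhaustion hhi
  obtain ⟨S, hS, hSm, hSF⟩ := hFa.ae_eq_mk.exists_measurable_mem
  set F := hFa.mk _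
  have hFm : Measurable F := hFa.stronglyMeasurable_mk.measurable
  have htop : ∀ q : ℝ, 0 < q → ∫⁻ x, ENNReal.ofReal (Real.exp (1 / q * ‖F x‖)) ∂mIoo = ⊤ := by
    intro q hq
    by_contra hne
    refine hcon ⟨hFa, 1 / q, by positivity, lt_of_le_of_lt (le_of_eq ?_) (lt_top_iff_ne_top.2 hne)⟩
    refine lintegral_congr_ae ?_
    filter_upwards [hS] with x hx
    rw [hSF x hx]
  set E' : ℕ → Set ℝ := fun n => E n ∩ S ∩ {x | ‖F x‖ ≤ n} with hE'
  have hE'mono : Monotone E' := fun m n hmn x hx =>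
    ⟨⟨hEmono hmn hx.1.1, hx.1.2⟩, (show ‖F x‖ ≤ n from le_trans hx.2 (Nat.cast_le.2 hmn))⟩
  have hE'm : ∀ n, MeasurableSet (E' n) := fun n =>
    ((hEm n).inter hSm).inter (measurableSet_le hFm.norm measurable_const)
  have hE'b : ∀ n, ∀ x ∈ E' n, ‖F x‖ ≤ n := fun n x hx => hx.2
  have hE'ex : ∀ᵐ x ∂mIoo, x ∈ ⋃ n, E' n := by
    filter_upwards [hEex, hS] with x ⟨n, hn⟩ hxS
    refine mem_iUnion.2 ⟨max n ⌈‖F x‖⌉₊, ⟨hEmono (le_max_left _ _) hn, hxS⟩, ?_⟩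
    exact (show ‖F x‖ ≤ _ from (Nat.le_ceil _).trans (Nat.cast_le.2 (le_max_right _ _)))
  set q : ℕ → ℝ := fun k => ((k : ℝ) + 1) * 2 ^ (k + 1) with hq
  have hq1 : ∀ k, 1 ≤ q k := fun k =>
    one_le_mul_of_one_le_of_one_le (by linarith [(Nat.cast_nonneg k : (0 : ℝ) ≤ k)])
      (one_le_pow₀ one_le_two)
  have hq0 : ∀ k, 0 < q k := fun k => one_pos.trans_le (hq1 k)
  set A : ℕ → Set ℝ := fun k => {x | 2 * q k < ‖F x‖} with hA
  have hAm : ∀ k, MeasurableSet (A k) := fun k => measurableSet_lt measurable_const hFm.norm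
  set ρ : ℕ → ℝ → ℝ≥0∞ := fun k x => ENNReal.ofReal (‖F x‖ * Real.exp (‖F x‖ / q k)) with hρ
  obtain ⟨ns, hns, hP⟩ := exists_strictMono_of_step (P := fun k n m =>
    ((k + 1 : ℕ) : ℝ≥0∞) ≤ ∫⁻ x in E' m \ E' n, ρ k x ∂(mIoo.restrict (A k))) fun k n => by
      refine exists_le_setLIntegral_sdiff hE'mono hE'm (fun n => ?_) ?_ (k + 1) n
      · refine lt_of_le_of_lt (setLIntegral_mono' (hE'm n)
          (g := fun _ => ENNReal.ofReal (n * Real.exp (n / q k))) fun x hx => ?_) ?_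
        · have := hE'b n x hx
          have := hq0 k
          refine ENNReal.ofReal_le_ofReal ?_
          gcongr
        · rw [setLIntegral_const]
          exact ENNReal.mul_lt_top ENNReal.ofReal_lt_top (measure_lt_top _ _)
      · rw [Measure.restrict_eq_self_of_ae_mem (ae_restrict_of_ae hE'ex)]
        exact lintegral_mul_exp_eq_top (hq0 k) hFm (htop _ (hq0 k)) (by linarith [hq1 k])
  set B : ℕ → Set ℝ := fun k => (E' (ns (k + 1)) \ E' (ns k)) ∩ A k with hB
  have hBm : ∀ k, MeasurableSet (B k) := fun k => ((hE'm _).diff (hE'm _)).inter (hAm k)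
  have hBd : Pairwise (Function.onFun Disjoint B) :=
    (pairwise_disjoint_sdiff_of_monotone hE'mono hns).mono fun i j hij =>
      Disjoint.mono inter_subset_left inter_subset_left hij
  have hex := fun k => exists_test_function (C := ((k + 1 : ℕ) : ℝ)) (hBm k) hFm (hq0 k)
    (by positivity) (fun x hx => (show 2 * q k < ‖F x‖ from hx.2).le)
    (fun x hx => hE'b _ x hx.1.1) (by
      have := hP k
      rwa [Measure.restrict_restrict ((hE'm _).diff (hE'm _)), ← ENNReal.ofReal_natCast] at this)
  choose v b hvm hb0 hvb hvF hvΦ using hex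
  obtain ⟨g, hgm, hgv, hg0⟩ := exists_glue hBm hBd hvm
  have hgL : MemLlogL g := by
    rw [memLlogL_iff hgm.aestronglyMeasurable]
    calc ∫⁻ x, ENNReal.ofReal (‖g x‖ * Real.log (2 + ‖g x‖)) ∂mIoo
        = ∫⁻ x in ⋃ k, B k, ENNReal.ofReal (‖g x‖ * Real.log (2 + ‖g x‖)) ∂mIoo := by
          refine (setLIntegral_eq_of_support_subset ?_).symm
          intro x hx
          by_contra hxB
          exact hx (by simp [hg0 x hxB])
      _ ≤ ∑' k, ∫⁻ x in B k, ENNReal.ofReal (‖g x‖ * Real.log (2 + ‖g x‖)) ∂mIoo :=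
          lintegral_iUnion_le _ _
      _ ≤ ∑' k : ℕ, ENNReal.ofReal ((1 / 2) ^ k) := by
          refine ENNReal.tsum_le_tsum fun k => ?_
          rw [setLIntegral_congr_fun (hBm k) (fun x hx => by rw [hgv k hx])]
          refine (hvΦ k).trans (le_of_eq ?_)
          congr 1
          simp only [hq]
          push_cast
          rw [pow_succ, one_div, inv_pow]
          field_simp
      _ < ⊤ := summable_geometric_two.tsum_ofReal_lt_top
  have hgi := hgL.integrable
  obtain ⟨N, m, hN⟩ := exists_uniform_bound_blocks hBm hBd hgi
    (θ := fun _ x r => ‖f x‖ₑ * ENNReal.ofReal r)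
    (fun N x => (ENNReal.continuous_const_mul enorm_ne_top).comp ENNReal.continuous_ofReal)
    (fun N G hG => hf.1.enorm.mul hG.norm.aemeasurable.ennreal_ofReal)
    fun D hD => by
      have h1 := (hd _ (hgL.indicator hD)).2
      rw [hasFiniteIntegral_iff_enorm] at h1
      obtain ⟨N, hN⟩ := ENNReal.exists_nat_gt h1.ne
      refine ⟨N, le_trans (le_of_eq ?_) hN.le⟩
      refine lintegral_congr fun x => ?_
      rw [enorm_mul, ofReal_norm]
  set k := max m (2 * N) with hk
  obtain ⟨G, G', hG, hG', hGG, h1, h2⟩ := hN k (le_max_left _ _)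
  have hp := hEp (ns (k + 1)) ((B k).indicator g) (b k)
    (hgm.aestronglyMeasurable.indicator (hBm k))
    (fun x => by
      by_cases hx : x ∈ B k
      · rw [indicator_of_mem hx, hgv k hx]
        exact hvb k x hx
      · rw [indicator_of_notMem hx, norm_zero]
        exact hb0 k)
    (fun x hx => indicator_of_notMem (fun h => hx h.1.1.1.1) g)
  have hI : ∫ t, (B k).indicator g t * FHT h t ∂mIoo = ((k + 1 : ℕ) : ℝ) := by
    rw [← hvF k, ← integral_indicator (hBm k)]
    refine integral_congr_ae (Eventually.of_forall fun t => ?_)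
    by_cases ht : t ∈ B k
    · simp only [indicator_of_mem ht, hgv k ht]
      rw [hSF t ht.1.1.1.2]
    · simp [ht]
  have hup : ∫⁻ x, ‖h x‖ₑ * ‖FHT ((B k).indicator g) x‖ₑ ∂mIoo ≤ N + N := by
    refine le_trans ?_ (add_le_add h1 h2)
    have hmG : AEMeasurable (fun x => ‖f x‖ₑ * ENNReal.ofReal ‖G x‖) mIoo :=
      hf.1.enorm.mul hG.norm.aemeasurable.ennreal_ofReal
    rw [← lintegral_add_left' hmG]
    refine lintegral_mono_ae ?_
    filter_upwards [hhf, hGG] with x hx hx2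
    rw [hx2, ofReal_norm, ofReal_norm, ← mul_add]
    exact mul_le_mul' (enorm_le_iff_norm_le.2 hx) enorm_sub_le
  have hfinal := hp.trans hup
  rw [hI, ← ofReal_norm, Complex.norm_real, Real.norm_natCast, ENNReal.ofReal_natCast] at hfinal
  have h3 : k + 1 ≤ N + N := by exact_mod_cast hfinal
  have h4 : 2 * N ≤ k := le_max_right _ _
  omega

theorem MemLexp.congr {u v : ℝ → ℂ} (hu : MemLexp u) (h : u =ᵐ[mIoo] v) : MemLexp v := by
  obtain ⟨hm, l, hl, hI⟩ := hu
  refine ⟨hm.congr h, l, hl, lt_of_eq_of_lt (lintegral_congr_ae ?_) hI⟩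
  filter_upwards [h] with x hx
  rw [hx]

theorem MemLexp.midpoint {u v : ℝ → ℂ} (hu : MemLexp u) (hv : MemLexp v) :
    MemLexp fun x => (1 / 2 : ℂ) * (u x + v x) := by
  obtain ⟨hmu, l, hl, hI⟩ := hu
  obtain ⟨hmv, l', hl', hI'⟩ := hv
  refine ⟨(hmu.add hmv).const_mul _, min l l', lt_min hl hl', ?_⟩
  have hmeas : AEMeasurable (fun x => ENNReal.ofReal (Real.exp (l * ‖u x‖))) mIoo :=
    ((hmu.norm.aemeasurable.const_mul l).exp).ennreal_ofReal
  refine lt_of_le_of_lt (lintegral_mono fun x => ?_)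
    ((lintegral_add_left' hmeas _).trans_lt (ENNReal.add_lt_top.2 ⟨hI, hI'⟩))
  rw [← ENNReal.ofReal_add (Real.exp_pos _).le (Real.exp_pos _).le]
  refine ENNReal.ofReal_le_ofReal ?_
  have h1 : ‖(1 / 2 : ℂ) * (u x + v x)‖ ≤ max ‖u x‖ ‖v x‖ := by
    rw [norm_mul]
    have h2 : ‖(1 / 2 : ℂ)‖ = 1 / 2 := by norm_num
    rw [h2]
    linarith [norm_add_le (u x) (v x), le_max_left ‖u x‖ ‖v x‖, le_max_right ‖u x‖ ‖v x‖]
  have h0 : 0 < min l l' := lt_min hl hl'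
  rcases le_total ‖u x‖ ‖v x‖ with h | h
  · rw [max_eq_right h] at h1
    have : Real.exp (min l l' * ‖(1 / 2 : ℂ) * (u x + v x)‖) ≤ Real.exp (l' * ‖v x‖) :=
      Real.exp_le_exp.2 (mul_le_mul (min_le_right _ _) h1 (norm_nonneg _) hl'.le)
    linarith [Real.exp_pos (l * ‖u x‖)]
  · rw [max_eq_left h] at h1
    have : Real.exp (min l l' * ‖(1 / 2 : ℂ) * (u x + v x)‖) ≤ Real.exp (l * ‖u x‖) :=
      Real.exp_le_exp.2 (mul_le_mul (min_le_left _ _) h1 (norm_nonneg _) hl.le)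
    linarith [Real.exp_pos (l' * ‖v x‖)]

/-- Every `z` in the closed unit disc is the average of `unitLift 1 z` and `unitLift (-1) z`,
which lie on the unit circle. -/
noncomputable def unitLift (s : ℝ) (z : ℂ) : ℂ :=
  (if z = 0 then 1 else z / (‖z‖ : ℂ)) *
    ((‖z‖ : ℂ) + ((s * Real.sqrt (1 - ‖z‖ ^ 2) : ℝ) : ℂ) * Complex.I)

theorem measurable_unitLift (s : ℝ) : Measurable (unitLift s) := by
  unfold unitLift
  refine Measurable.mul (Measurable.ite (measurableSet_singleton 0) measurable_const ?_) ?_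
  · fun_prop
  · fun_prop

theorem norm_unitLift {s : ℝ} (hs : s ^ 2 = 1) {z : ℂ} (hz : ‖z‖ ≤ 1) : ‖unitLift s z‖ = 1 := by
  unfold unitLift
  rw [norm_mul]
  have h1 : ‖(if z = 0 then 1 else z / (‖z‖ : ℂ))‖ = 1 := by
    split_ifs with h
    · simp
    · rw [norm_div, Complex.norm_real, norm_norm, div_self (norm_ne_zero_iff.2 h)]
  have h2 : 0 ≤ 1 - ‖z‖ ^ 2 := by nlinarith [norm_nonneg z]
  rw [h1, one_mul, Complex.norm_add_mul_I, mul_pow, Real.sq_sqrt h2, hs]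
  norm_num

theorem half_mul_unitLift_add (z : ℂ) :
    (1 / 2 : ℂ) * (unitLift 1 z + unitLift (-1) z) = z := by
  unfold unitLift
  split_ifs with h
  · simp [h]
  · have : (‖z‖ : ℂ) ≠ 0 := by simpa using h
    field_simp
    push_cast
    ring

theorem memLexp_FHT_of_unimodular {f : ℝ → ℂ} (hf : Integrable f mIoo)
    (hc : ∀ θ : ℝ → ℂ, AEStronglyMeasurable θ mIoo → (∀ᵐ x ∂mIoo, ‖θ x‖ = 1) →
      MemLexp (FHT fun x => θ x * f x))
    {h : ℝ → ℂ} (hh : AEStronglyMeasurable h mIoo) (hhf : ∀ᵐ x ∂mIoo, ‖h x‖ ≤ ‖f x‖) :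
    MemLexp (FHT h) := by
  have hm : ∀ s : ℝ, AEStronglyMeasurable (fun x => unitLift s (h x / f x)) mIoo := fun s =>
    ((measurable_unitLift s).comp_aemeasurable
      (hh.aemeasurable.div hf.1.aemeasurable)).aestronglyMeasurable
  have hn : ∀ s : ℝ, s ^ 2 = 1 → ∀ᵐ x ∂mIoo, ‖unitLift s (h x / f x)‖ = 1 := fun s hs => by
    filter_upwards [hhf] with x hx
    refine norm_unitLift hs ?_
    rw [norm_div]
    exact div_le_one_of_le₀ hx (norm_nonneg _)
  have hi : ∀ s : ℝ, s ^ 2 = 1 →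
      Integrable (fun x => unitLift s (h x / f x) * f x) mIoo := fun s hs => by
    refine hf.mono ((hm s).mul hf.1) ?_
    filter_upwards [hn s hs] with x hx
    rw [norm_mul, hx, one_mul]
  have h1 := hi 1 (by norm_num)
  have h2 := hi (-1) (by norm_num)
  have hsum : Integrable (fun x => unitLift 1 (h x / f x) * f x +
      unitLift (-1) (h x / f x) * f x) mIoo := h1.add h2
  refine ((hc _ (hm 1) (hn 1 (by norm_num))).midpoint
    (hc _ (hm (-1)) (hn (-1) (by norm_num)))).congr ?_
  have hcong : FHT (fun x => (1 / 2 : ℂ) * (unitLift 1 (h x / f x) * f x +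
      unitLift (-1) (h x / f x) * f x)) =ᵐ[mIoo] FHT h := by
    refine FHT_congr_ae (hsum.const_mul _) ?_
    filter_upwards [hhf] with x hx
    rw [← add_mul, ← mul_assoc, half_mul_unitLift_add]
    by_cases h0 : f x = 0
    · have : h x = 0 := by simpa [h0] using hx
      simp [h0, this]
    · exact div_mul_cancel₀ _ h0
  filter_upwards [hcong, FHT_const_mul_ae hsum (1 / 2), FHT_add_ae h1 h2] with t e1 e2 e3
  rw [← e1, e2, e3]

end

/-- for `f ∈ L¹(-1,1)` the following are equivalent:
(a) `T h ∈ L_exp` for every measurable `h` with `|h| ≤ |f|` a.e.;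
(b) `T(f χ_A) ∈ L_exp` for every Borel set `A`;
(c) `T(θ f) ∈ L_exp` for every measurable `θ` with `|θ| = 1` a.e.;
(d) `f · T g ∈ L¹(-1,1)` for every `g ∈ L log L`. -/
theorem stmt18 (f : ℝ → ℂ) (hf : MeasureTheory.Integrable f mIoo) :
    [(∀ h : ℝ → ℂ, MeasureTheory.AEStronglyMeasurable h mIoo →
        (∀ᵐ x ∂mIoo, ‖h x‖ ≤ ‖f x‖) → MemLexp (FHT h)),
      (∀ A : Set ℝ, MeasurableSet A → MemLexp (FHT (A.indicator f))),
      (∀ θ : ℝ → ℂ, MeasureTheory.AEStronglyMeasurable θ mIoo →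
        (∀ᵐ x ∂mIoo, ‖θ x‖ = 1) → MemLexp (FHT fun x => θ x * f x)),
      (∀ g : ℝ → ℂ, MemLlogL g →
        MeasureTheory.Integrable (fun x => f x * FHT g x) mIoo)].TFAE := by
  tfae_have 1 → 2 := fun ha A hA => ha _ (hf.1.indicator hA)
    (Eventually.of_forall fun x => norm_indicator_le_norm_self f x)
  tfae_have 1 → 3 := fun ha θ hθ h1 => ha _ (hθ.mul hf.1) (by
    filter_upwards [h1] with x hx
    rw [norm_mul, hx, one_mul])
  tfae_have 3 → 1 := fun hc _ hh hhf => memLexp_FHT_of_unimodular hf hc hh hhf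
  tfae_have 2 → 4 := fun hb _ hg => integrable_mul_FHT_of_memLexp_indicator hf hb hg
  tfae_have 4 → 1 := fun hd _ hh hhf => memLexp_FHT_of_integrable_mul hf hd hh hhf
  tfae_finish
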